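/- arXiv:2509.03663 — 4 statements merged into one kernel-verified Lean document; each statement's English description precedes it below -/
import Mathlib

section
/- (Gleason–Kahane–Żelazko) Let A be a complex unital Banach algebra and suppose φ : A → ℂ is linear. Then φ is a character of A if and only if φ(x) ∈ σ(x) for every x ∈ A. -/
open scoped ComplexConjugate

/-- A character of a complex algebra: a nonzero linear multiplicative functional. -/
def IsCharacter {A : Type*} [Ring A] [Algebra ℂ A] (ψ : A → ℂ) : Prop :=
  ψ ≠ 0 ∧ IsLinearMap ℂ ψ ∧ ∀ x y : A, ψ (x * y) = ψ x * ψ y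

/-- φ is spectrally multiplicative if φ(x)·φ(y) ∈ σ(x·y) for all x, y. -/
def SpectrallyMultiplicative {A : Type*} [Ring A] [Algebra ℂ A] (φ : A → ℂ) : Prop :=
  ∀ x y : A, φ x * φ y ∈ spectrum ℂ (x * y)

/-- The Pták functional s(x) = √(ρ(x⋆x)). -/
noncomputable def ptak {A : Type*} [NormedRing A] [NormedAlgebra ℂ A] [StarRing A] (x : A) : ℝ :=
  Real.sqrt ((spectralRadius ℂ (star x * x)).toReal)

/-- The real part Re(x) = (x + x⋆)/2. -/
noncomputable def reP {A : Type*} [Ring A] [Algebra ℂ A] [StarRing A] (x : A) : A :=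
  (2 : ℂ)⁻¹ • (x + star x)

/-- The imaginary part Im(x) = (x - x⋆)/(2i). -/
noncomputable def imP {A : Type*} [Ring A] [Algebra ℂ A] [StarRing A] (x : A) : A :=
  ((2 : ℂ) * Complex.I)⁻¹ • (x - star x)

/-- Newton's identity in degree two, for multisets. -/
theorem Multiset.sum_sq_eq_sum_map_sq_add_two_mul_esymm {R : Type*} [CommSemiring R]
    (s : Multiset R) : s.sum ^ 2 = (s.map (· ^ 2)).sum + 2 * s.esymm 2 := by
  induction s using Multiset.induction_on with
  | empty => simp [Multiset.esymm, Multiset.powersetCard_zero_right]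
  | cons a s ih =>
    have h : (a ::ₘ s).esymm 2 = s.esymm 2 + a * s.sum := by
      simp only [Multiset.esymm, Multiset.powersetCard_cons, Multiset.powersetCard_one,
        Multiset.map_add, Multiset.sum_add, Multiset.map_map, Function.comp_def,
        Multiset.prod_cons, Multiset.prod_singleton]
      exact congrArg _ (by simpa using Multiset.sum_map_mul_left (s := s) (a := a) (f := id))
    rw [h, Multiset.sum_cons, Multiset.map_cons, Multiset.sum_cons, add_sq, ih]
    ring

section GleasonKahaneZelazko

open Polynomial

variable {A : Type*} [Ring A] [Algebra ℂ A]

/-- The polynomial `z ↦ φ ((z - x) ^ n)`. -/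
noncomputable def LinearMap.powSubPolynomial (φ : A →ₗ[ℂ] ℂ) (x : A) (n : ℕ) : ℂ[X] :=
  ∑ m ∈ Finset.range (n + 1), C (n.choose m * φ ((-x) ^ (n - m))) * X ^ m

theorem LinearMap.eval_powSubPolynomial (φ : A →ₗ[ℂ] ℂ) (x : A) (n : ℕ) (z : ℂ) :
    (φ.powSubPolynomial x n).eval z = φ ((algebraMap ℂ A z - x) ^ n) := by
  rw [sub_eq_add_neg, (Algebra.commute_algebraMap_left z (-x)).add_pow, map_sum,
    powSubPolynomial, eval_finsetSum]
  refine Finset.sum_congr rfl fun m _ => ?_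
  have h : algebraMap ℂ A z ^ m * (-x) ^ (n - m) * (n.choose m : A)
      = (z ^ m * n.choose m : ℂ) • (-x) ^ (n - m) := by
    rw [Algebra.smul_def, map_mul, map_pow, map_natCast, mul_assoc, mul_assoc,
      (Nat.cast_commute (n.choose m) ((-x) ^ (n - m))).eq]
  rw [h, map_smul]
  simp only [eval_mul, eval_C, eval_pow, eval_X, smul_eq_mul]
  ring

theorem LinearMap.coeff_powSubPolynomial (φ : A →ₗ[ℂ] ℂ) (x : A) {n m : ℕ} (hm : m ≤ n) :
    (φ.powSubPolynomial x n).coeff m = n.choose m * φ ((-x) ^ (n - m)) := by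
  simp only [powSubPolynomial, finsetSum_coeff, coeff_C_mul, coeff_X_pow]
  simp [Nat.lt_succ_of_le hm]

theorem LinearMap.natDegree_powSubPolynomial (φ : A →ₗ[ℂ] ℂ) (h : φ 1 = 1) (x : A) (n : ℕ) :
    (φ.powSubPolynomial x n).natDegree = n := by
  refine natDegree_eq_of_le_of_coeff_ne_zero ?_ ?_
  · refine natDegree_sum_le_of_forall_le _ _ fun m hm => ?_
    exact (natDegree_C_mul_X_pow_le _ _).trans (Nat.lt_succ_iff.mp (Finset.mem_range.mp hm))
  · simp [φ.coeff_powSubPolynomial x le_rfl, h]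

theorem LinearMap.mem_spectrum_of_mem_roots_powSubPolynomial {φ : A →ₗ[ℂ] ℂ}
    (hφ : ∀ x, φ x ∈ spectrum ℂ x) {x : A} {n : ℕ} {z : ℂ}
    (hz : z ∈ (φ.powSubPolynomial x n).roots) : z ∈ spectrum ℂ x := by
  have h0 := hφ ((algebraMap ℂ A z - x) ^ n)
  rw [← φ.eval_powSubPolynomial, (isRoot_of_mem_roots hz).eq_zero, spectrum.zero_mem_iff] at h0
  exact fun hu => h0 (hu.pow n)

theorem LinearMap.sq_mul_sq_apply_eq_sum_roots {φ : A →ₗ[ℂ] ℂ} (h : φ 1 = 1) (x : A) (k : ℕ) :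
    ((k + 2 : ℂ) * φ x) ^ 2 = ((φ.powSubPolynomial x (k + 2)).roots.map (· ^ 2)).sum
      + (k + 2) * (k + 1) * φ (x ^ 2) := by
  have hdeg := φ.natDegree_powSubPolynomial h x (k + 2)
  have hcard := splits_iff_card_roots.mp (IsAlgClosed.splits (φ.powSubPolynomial x (k + 2)))
  have hlead : (φ.powSubPolynomial x (k + 2)).leadingCoeff = 1 := by
    rw [leadingCoeff, hdeg, φ.coeff_powSubPolynomial x le_rfl]
    simp [h]
  have h₁ := coeff_eq_esymm_roots_of_card hcard (k := k + 1) (by lia)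
  have h₂ := coeff_eq_esymm_roots_of_card hcard (k := k) (by lia)
  rw [hlead, hdeg, φ.coeff_powSubPolynomial x (by lia)] at h₁ h₂
  have e₁ : k + 2 - (k + 1) = 1 := by lia
  have e₂ : k + 2 - k = 2 := by lia
  rw [e₁, Nat.choose_symm_of_eq_add (show k + 2 = k + 1 + 1 from rfl), Nat.choose_one_right] at h₁
  rw [e₂, Nat.choose_symm_of_eq_add (show k + 2 = k + 2 from rfl)] at h₂
  have hchoose : ((k + 2).choose 2 : ℂ) = (k + 2) * (k + 1) / 2 := by
    rw [Nat.cast_choose_two]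
    push_cast
    ring
  have hsum : (φ.powSubPolynomial x (k + 2)).roots.esymm 1
      = (φ.powSubPolynomial x (k + 2)).roots.sum := by
    simp [Multiset.esymm, Multiset.powersetCard_one]
  have newton := (φ.powSubPolynomial x (k + 2)).roots.sum_sq_eq_sum_map_sq_add_two_mul_esymm
  rw [hsum] at h₁
  rw [hchoose] at h₂
  simp only [pow_one, map_neg, neg_sq] at h₁ h₂
  push_cast at h₁
  have h₁' : (φ.powSubPolynomial x (k + 2)).roots.sum = (k + 2) * φ x := by linear_combination h₁
  rw [h₁'] at newton
  linear_combination newton - 2 * h₂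

/-- A linear functional fixing the unit and preserving squares (a unital Jordan homomorphism
to `ℂ`) is multiplicative. -/
theorem LinearMap.map_mul_of_map_sq {φ : A →ₗ[ℂ] ℂ} (h : φ 1 = 1)
    (hsq : ∀ x, φ (x ^ 2) = φ x ^ 2) (x y : A) : φ (x * y) = φ x * φ y := by
  have jordan (x y : A) : φ (x * y + y * x) = 2 * (φ x * φ y) := by
    have e : x * y + y * x = (x + y) ^ 2 - x ^ 2 - y ^ 2 := by noncomm_ring
    rw [e, map_sub, map_sub, hsq, hsq, hsq, map_add]
    ring
  have ker (x y : A) (hx : φ x = 0) : φ (x * y) = 0 := by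
    have hadd : φ (x * y + y * x) = 0 := by rw [jordan, hx]; ring
    have hsub : φ (x * y - y * x) = 0 := by
      have e : (x * y - y * x) ^ 2
          = (x * (y * x * y) + y * x * y * x) + (x * (y * x * y) + y * x * y * x)
            - (x * y + y * x) ^ 2 := by noncomm_ring
      have := hsq (x * y - y * x)
      rw [e, map_sub, map_add, jordan, hsq, hadd, hx] at this
      exact pow_eq_zero_iff two_ne_zero |>.mp (by simpa using this.symm)
    rw [map_add] at hadd
    rw [map_sub] at hsub
    linear_combination (hadd + hsub) / 2
  have := ker (x - φ x • 1) y (by simp [h])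
  rw [sub_mul, smul_one_mul, map_sub, map_smul, smul_eq_mul] at this
  exact sub_eq_zero.mp this

end GleasonKahaneZelazko

theorem LinearMap.map_sq_of_forall_mem_spectrum {A : Type*} [NormedRing A] [NormedAlgebra ℂ A]
    [CompleteSpace A] {φ : A →ₗ[ℂ] ℂ} (hφ : ∀ x, φ x ∈ spectrum ℂ x) (h : φ 1 = 1) (x : A) :
    φ (x ^ 2) = φ x ^ 2 := by
  set M := ‖x‖ * ‖(1 : A)‖
  have bound (k : ℕ) : k * ‖φ x ^ 2 - φ (x ^ 2)‖ ≤ M ^ 2 + ‖φ (x ^ 2)‖ := by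
    set S := ((φ.powSubPolynomial x (k + 2)).roots.map (· ^ 2)).sum with hS
    have hSle : ‖S‖ ≤ (k + 2) * M ^ 2 := by
      refine (norm_multiset_sum_le _).trans ?_
      refine (Multiset.sum_le_card_nsmul _ (M ^ 2) fun r hr => ?_).trans ?_
      · simp only [Multiset.map_map, Multiset.mem_map] at hr
        obtain ⟨z, hz, rfl⟩ := hr
        have := spectrum.norm_le_norm_mul_of_mem (mem_spectrum_of_mem_roots_powSubPolynomial hφ hz)
        simpa using pow_le_pow_left₀ (norm_nonneg z) this 2
      · have hc := (φ.powSubPolynomial x (k + 2)).card_roots'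
        rw [φ.natDegree_powSubPolynomial h] at hc
        rw [Multiset.card_map, Multiset.card_map, nsmul_eq_mul]
        gcongr
        exact_mod_cast hc
    have key : (k + 2 : ℂ) * ((k + 2) * (φ x ^ 2 - φ (x ^ 2))) = S - (k + 2) * φ (x ^ 2) := by
      linear_combination sq_mul_sq_apply_eq_sum_roots h x k
    have hk : ‖(k + 2 : ℂ)‖ = k + 2 := by
      exact_mod_cast Complex.norm_natCast (k + 2)
    have hle := norm_sub_le S ((k + 2) * φ (x ^ 2))
    rw [← key, norm_mul, norm_mul, norm_mul, hk] at hle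
    have : (k + 2 : ℝ) * ‖φ x ^ 2 - φ (x ^ 2)‖ ≤ M ^ 2 + ‖φ (x ^ 2)‖ :=
      le_of_mul_le_mul_left (by linarith) (show (0 : ℝ) < k + 2 by positivity)
    linarith [norm_nonneg (φ x ^ 2 - φ (x ^ 2))]
  by_contra hne
  have hpos : 0 < ‖φ x ^ 2 - φ (x ^ 2)‖ := norm_pos_iff.mpr (sub_ne_zero.mpr (Ne.symm hne))
  obtain ⟨k, hk⟩ := exists_nat_gt ((M ^ 2 + ‖φ (x ^ 2)‖) / ‖φ x ^ 2 - φ (x ^ 2)‖)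
  exact (bound k).not_gt ((div_lt_iff₀ hpos).mp hk)

theorem IsCharacter.map_one {A : Type*} [Ring A] [Algebra ℂ A] {ψ : A → ℂ}
    (hψ : IsCharacter ψ) : ψ 1 = 1 := by
  obtain ⟨hne, -, hmul⟩ := hψ
  obtain ⟨x, hx⟩ := Function.ne_iff.mp hne
  exact mul_left_cancel₀ hx (by rw [← hmul, mul_one, mul_one])

/-- The Gleason–Kahane–Żelazko theorem. -/
theorem stmt_13 {A : Type*} [NormedRing A] [NormedAlgebra ℂ A] [CompleteSpace A]
    (φ : A →ₗ[ℂ] ℂ) :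
    IsCharacter (⇑φ) ↔ ∀ x : A, φ x ∈ spectrum ℂ x := by
  constructor
  · intro hφ x hu
    have h1 := hφ.map_one
    obtain ⟨v, hv⟩ := hu.exists_right_inv
    have hx : φ (algebraMap ℂ A (φ x) - x) = 0 := by
      simp [Algebra.algebraMap_eq_smul_one, h1]
    have := hφ.2.2 (algebraMap ℂ A (φ x) - x) v
    rw [hv, h1, hx, zero_mul] at this
    exact one_ne_zero this
  · intro hφ
    have : Nontrivial A := by
      by_contra hA
      have := not_nontrivial_iff_subsingleton.mp hA
      exact hφ 0 (isUnit_of_subsingleton _)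
    have h1 : φ 1 = 1 := by simpa [spectrum.one_eq] using hφ 1
    refine ⟨fun h0 => ?_, φ.isLinear,
      LinearMap.map_mul_of_map_sq h1 (LinearMap.map_sq_of_forall_mem_spectrum hφ h1)⟩
    exact one_ne_zero (h1.symm.trans (congrFun h0 1))
end

section
/- (Kowalski–Słodkowski) Let A be a complex unital Banach algebra. A function φ : A → ℂ (not assumed linear) is a character of A if and only if φ(0) = 0 and φ(x) − φ(y) ∈ σ(x − y) for every x, y ∈ A. -/
open scoped ComplexConjugate

namespace KowalskiSlodkowski

open Complex MeasureTheory Filter Topology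
open scoped Convolution NNReal

theorem norm_wedgeIntegral_add_le_of_contDiff {f : ℂ → ℂ} (hf : ContDiff ℝ 1 f) {ε : ℝ}
    (hε : ∀ z, ‖fderiv ℝ f z 1 + I * fderiv ℝ f z I‖ ≤ ε) (z w : ℂ) :
    ‖wedgeIntegral z w f + wedgeIntegral w z f‖ ≤ ε * |w.im - z.im| * |w.re - z.re| := by
  have hc : Continuous (fderiv ℝ f) := hf.continuous_fderiv one_ne_zero
  have h1 : ∀ z, I • fderiv ℝ f z 1 - fderiv ℝ f z I =
      I * (fderiv ℝ f z 1 + I * fderiv ℝ f z I) := fun z ↦ by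
    rw [mul_add, ← mul_assoc, I_mul_I, smul_eq_mul]; ring
  rw [wedgeIntegral_add_wedgeIntegral_eq, integral_boundary_rect_of_differentiableOn_real f z w
    (hf.differentiable one_ne_zero).differentiableOn]
  · refine intervalIntegral.norm_integral_le_of_norm_le_const fun x _ ↦ ?_
    refine intervalIntegral.norm_integral_le_of_norm_le_const fun y _ ↦ ?_
    rw [h1, norm_mul, norm_I, one_mul]
    exact hε _
  · refine ContinuousOn.integrableOn_compact ?_ (Continuous.continuousOn (by fun_prop))
    exact isCompact_uIcc.reProdIm isCompact_uIcc

theorem norm_wedgeIntegral_sub_le {f g : ℂ → ℂ} (hf : Continuous f) (hg : Continuous g) {δ : ℝ}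
    (h : ∀ z, ‖f z - g z‖ ≤ δ) (z w : ℂ) :
    ‖wedgeIntegral z w f - wedgeIntegral z w g‖ ≤ δ * (|w.re - z.re| + |w.im - z.im|) := by
  have key : wedgeIntegral z w f - wedgeIntegral z w g =
      (∫ x in z.re..w.re, (f (x + z.im * I) - g (x + z.im * I))) +
        I • ∫ y in z.im..w.im, (f (w.re + y * I) - g (w.re + y * I)) := by
    rw [intervalIntegral.integral_sub, intervalIntegral.integral_sub, wedgeIntegral, wedgeIntegral,
      smul_sub]
    · ring
    all_goals exact Continuous.intervalIntegrable (by fun_prop) _ _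
  rw [key, mul_add]
  refine (norm_add_le _ _).trans (add_le_add ?_ ?_)
  · exact intervalIntegral.norm_integral_le_of_norm_le_const fun x _ ↦ h _
  · rw [norm_smul, norm_I, one_mul]
    exact intervalIntegral.norm_integral_le_of_norm_le_const fun x _ ↦ h _

section
variable {E : Type*} [NormedAddCommGroup E] [NormedSpace ℂ E] [FiniteDimensional ℝ E]
  [MeasurableSpace E] [BorelSpace E] {μ : Measure E} [μ.IsAddHaarMeasure]

theorem hasFDerivAt_normed_convolution {F : E → ℂ} {C : ℝ≥0} (hF : LipschitzWith C F)
    (ρ : ContDiffBump (0 : E)) (p : E) :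
    Integrable (fun t ↦ ρ.normed μ t • fderiv ℝ F (p - t)) μ ∧
    HasFDerivAt (ρ.normed μ ⋆[ContinuousLinearMap.lsmul ℝ ℝ, μ] F : E → ℂ)
      (∫ t, ρ.normed μ t • fderiv ℝ F (p - t) ∂μ) p := by
  have hFc := hF.continuous
  have hρ : Continuous (ρ.normed μ) := ρ.continuous_normed
  have hsupp : HasCompactSupport (ρ.normed μ) := ρ.hasCompactSupport_normed
  have hdiff : ∀ᵐ t ∂μ, DifferentiableAt ℝ F (p - t) :=
    (Measure.measurePreserving_sub_left μ p).quasiMeasurePreserving.ae hF.ae_differentiableAt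
  refine hasFDerivAt_integral_of_dominated_loc_of_lip (s := Set.univ)
    (F := fun p t ↦ ρ.normed μ t • F (p - t)) (bound := fun t ↦ ρ.normed μ t * C) univ_mem
    (.of_forall fun x ↦ Continuous.aestronglyMeasurable (by fun_prop)) ?_ ?_ ?_ ?_ ?_
  · exact Continuous.integrable_of_hasCompactSupport (by fun_prop) hsupp.smul_right
  · exact (hρ.measurable.smul ((measurable_fderiv ℝ F).comp
      (measurable_const.sub measurable_id))).aestronglyMeasurable
  · refine .of_forall fun t ↦ LipschitzWith.lipschitzOnWith ?_
    refine LipschitzWith.of_dist_le_mul fun x y ↦ ?_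
    have h0 := ρ.nonneg_normed (μ := μ) t
    rw [dist_eq_norm, ← smul_sub, norm_smul, Real.norm_of_nonneg h0, Real.coe_nnabs,
      abs_of_nonneg (by positivity), mul_assoc]
    gcongr
    simpa [dist_eq_norm] using hF.dist_le_mul (x - t) (y - t)
  · exact (hρ.integrable_of_hasCompactSupport hsupp).mul_const _
  · filter_upwards [hdiff] with t ht
    exact HasFDerivAt.const_smul (R := ℝ)
      (ht.hasFDerivAt.comp p ((hasFDerivAt_id p).sub_const t)) (ρ.normed μ t)

theorem norm_dbar_normed_convolution_le {F : E → ℂ} {C : ℝ≥0} (hF : LipschitzWith C F)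
    {e : E} {ε : ℝ}
    (hε : ∀ p, DifferentiableAt ℝ F p → ‖fderiv ℝ F p e + I * fderiv ℝ F p (I • e)‖ ≤ ε)
    (ρ : ContDiffBump (0 : E)) (p : E) :
    ‖fderiv ℝ (ρ.normed μ ⋆[ContinuousLinearMap.lsmul ℝ ℝ, μ] F : E → ℂ) p e +
      I * fderiv ℝ (ρ.normed μ ⋆[ContinuousLinearMap.lsmul ℝ ℝ, μ] F : E → ℂ) p (I • e)‖ ≤ ε := by
  obtain ⟨hi, hd⟩ := hasFDerivAt_normed_convolution (μ := μ) hF ρ p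
  have hdiff : ∀ᵐ t ∂μ, DifferentiableAt ℝ F (p - t) :=
    (Measure.measurePreserving_sub_left μ p).quasiMeasurePreserving.ae hF.ae_differentiableAt
  have hρi : Integrable (ρ.normed μ) μ :=
    ρ.continuous_normed.integrable_of_hasCompactSupport ρ.hasCompactSupport_normed
  rw [hd.fderiv, ContinuousLinearMap.integral_apply hi, ContinuousLinearMap.integral_apply hi,
    ← integral_const_mul, ← integral_add (hi.apply_continuousLinearMap e)
      ((hi.apply_continuousLinearMap (I • e)).const_mul I)]
  calc _ ≤ ∫ t, ρ.normed μ t * ε ∂μ := by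
        refine norm_integral_le_of_norm_le (hρi.mul_const ε) ?_
        filter_upwards [hdiff] with t ht
        simp only [smul_apply]
        rw [mul_smul_comm, ← smul_add, norm_smul, Real.norm_of_nonneg (ρ.nonneg_normed t)]
        exact mul_le_mul_of_nonneg_left (hε _ ht) (ρ.nonneg_normed t)
    _ = ε := by rw [integral_mul_const, ρ.integral_normed, one_mul]

theorem norm_wedgeIntegral_add_le_of_lipschitz {F : E → ℂ} {C : ℝ≥0} (hF : LipschitzWith C F)
    {e : E} {ε : ℝ}
    (hε : ∀ p, DifferentiableAt ℝ F p → ‖fderiv ℝ F p e + I * fderiv ℝ F p (I • e)‖ ≤ ε)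
    (z w : ℂ) :
    ‖wedgeIntegral z w (fun t ↦ F (t • e)) + wedgeIntegral w z (fun t ↦ F (t • e))‖ ≤
      ε * |w.im - z.im| * |w.re - z.re| := by
  let μ : Measure E := Measure.addHaar
  have hFc := hF.continuous
  set L := |w.re - z.re| + |w.im - z.im|
  have hlim : Tendsto (fun δ : ℝ ↦ ε * |w.im - z.im| * |w.re - z.re| + 2 * (C * δ * L))
      (𝓝[>] 0) (𝓝 (ε * |w.im - z.im| * |w.re - z.re|)) := by
    refine tendsto_nhdsWithin_of_tendsto_nhds ?_
    have : Continuous (fun δ : ℝ ↦ ε * |w.im - z.im| * |w.re - z.re| + 2 * (C * δ * L)) := by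
      fun_prop
    simpa using this.tendsto 0
  refine ge_of_tendsto hlim ?_
  filter_upwards [self_mem_nhdsWithin] with δ (hδ : 0 < δ)
  let ρ : ContDiffBump (0 : E) := ⟨δ / 2, δ, by positivity, by linarith⟩
  set Φ : E → ℂ := ρ.normed μ ⋆[ContinuousLinearMap.lsmul ℝ ℝ, μ] F with hΦ
  have hΦd : ContDiff ℝ 1 Φ := ρ.hasCompactSupport_normed.contDiff_convolution_left _
    ρ.contDiff_normed hFc.locallyIntegrable
  let T : ℂ →L[ℝ] E := (ContinuousLinearMap.toSpanSingleton ℂ e).restrictScalars ℝ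
  have hT : ∀ t, T t = t • e := fun t ↦ rfl
  have hΦT : ContDiff ℝ 1 (fun t : ℂ ↦ Φ (t • e)) := hΦd.comp T.contDiff
  have hder : ∀ t v : ℂ, fderiv ℝ (fun t : ℂ ↦ Φ (t • e)) t v = fderiv ℝ Φ (t • e) (v • e) := by
    intro t v
    have := ((hΦd.differentiable one_ne_zero (T t)).hasFDerivAt.comp t T.hasFDerivAt).fderiv
    exact DFunLike.congr_fun this v
  have h1 := norm_wedgeIntegral_add_le_of_contDiff hΦT (ε := ε) (fun t ↦ by
    rw [hder, hder, one_smul]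
    exact norm_dbar_normed_convolution_le hF hε ρ _) z w
  have hclose : ∀ t : ℂ, ‖F (t • e) - Φ (t • e)‖ ≤ C * δ := by
    intro t
    rw [← dist_eq_norm, dist_comm]
    refine ContDiffBump.dist_normed_convolution_le hFc.aestronglyMeasurable fun x hx ↦ ?_
    refine (hF.dist_le_mul _ _).trans ?_
    gcongr
    exact (Metric.mem_ball.1 hx).le
  have hc : Continuous fun t : ℂ ↦ F (t • e) := by fun_prop
  have h2 := norm_wedgeIntegral_sub_le hc hΦT.continuous hclose z w
  have h3 := norm_wedgeIntegral_sub_le hc hΦT.continuous hclose w z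
  rw [abs_sub_comm z.re, abs_sub_comm z.im] at h3
  set a := wedgeIntegral z w (fun t ↦ F (t • e))
  set b := wedgeIntegral w z (fun t ↦ F (t • e))
  set a' := wedgeIntegral z w (fun t ↦ Φ (t • e))
  set b' := wedgeIntegral w z (fun t ↦ Φ (t • e))
  calc ‖a + b‖ = ‖(a' + b') + ((a - a') + (b - b'))‖ := by congr 1; ring
    _ ≤ ‖a' + b'‖ + (‖a - a'‖ + ‖b - b'‖) :=
      (norm_add_le _ _).trans (add_le_add le_rfl (norm_add_le _ _))
    _ ≤ _ := by linarith
end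

theorem exists_add_conj_of_real_linear {E : Type*} [AddCommGroup E] [Module ℂ E]
    (D : E →ₗ[ℝ] ℂ) :
    ∃ g h : E →ₗ[ℂ] ℂ, ∀ v, D v = g v + conj (h v) := by
  have hsmul : ∀ (c : ℂ) (v : E), D (c • v) = c.re * D v + c.im * D (I • v) := by
    intro c v
    conv_lhs => rw [← re_add_im c]
    have : ((c.re : ℂ) + c.im * I) • v = c.re • v + c.im • (I • v) := by
      rw [add_smul, mul_smul, coe_smul, coe_smul]
    rw [this, map_add, map_smul, map_smul, real_smul, real_smul]
  have hII : ∀ v, D (I • I • v) = -D v := fun v ↦ by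
    rw [smul_smul, I_mul_I, neg_one_smul, map_neg]
  refine ⟨{ toFun := fun v ↦ (D v - I * D (I • v)) / 2, map_add' := ?_, map_smul' := ?_ },
    { toFun := fun v ↦ conj ((D v + I * D (I • v)) / 2), map_add' := ?_, map_smul' := ?_ }, ?_⟩
  · intro v w
    simp only [smul_add, map_add]
    ring
  · intro c v
    rw [smul_comm I c v, hsmul, hsmul c (I • v), hII, RingHom.id_apply, smul_eq_mul]
    linear_combination (D v - I * D (I • v)) / 2 * (re_add_im c) +
      c.im * D (I • v) / 2 * I_mul_I
  · intro v w
    rw [← map_add]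
    congr 1
    simp only [smul_add, map_add]
    ring
  · intro c v
    rw [smul_comm I c v, hsmul, hsmul c (I • v), hII, RingHom.id_apply, smul_eq_mul]
    conv_rhs => rw [← conj_conj c, ← map_mul]
    congr 1
    have : conj c = c.re - c.im * I := by
      apply Complex.ext <;> simp
    rw [this]
    linear_combination c.im * D (I • v) / 2 * I_mul_I
  · intro v
    simp only [LinearMap.coe_mk, AddHom.coe_mk, conj_conj]
    ring

theorem eq_of_mem_spectrum_algebraMap {A : Type*} [Ring A] [Algebra ℂ A] {c d : ℂ}
    (h : c ∈ spectrum ℂ (algebraMap ℂ A d)) : c = d := by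
  by_contra hne
  refine h ?_
  rw [spectrum.mem_resolventSet_iff, ← map_sub]
  exact (IsUnit.mk0 _ (sub_ne_zero.2 hne)).map _

theorem norm_ne_norm_of_isUnit {A E : Type*} [Ring A] [Algebra ℂ A] [AddCommGroup E] [Module ℂ E]
    {T : E →ₗ[ℂ] A} {g h : E →ₗ[ℂ] ℂ} (hD : ∀ v, g v + conj (h v) ∈ spectrum ℂ (T v))
    {v : E} (hv : IsUnit (T v)) : ‖g v‖ ≠ ‖h v‖ := by
  intro heq
  obtain ⟨c, hc, hcv⟩ : ∃ c : ℂ, ‖c‖ = 1 ∧ c * g v = -conj (h v) := by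
    rcases eq_or_ne (g v) 0 with h0 | h0
    · refine ⟨1, norm_one, ?_⟩
      have : h v = 0 := by simpa [h0] using heq.symm
      simp [h0, this]
    · refine ⟨-conj (h v) / g v, ?_, div_mul_cancel₀ _ h0⟩
      rw [norm_div, norm_neg, norm_conj, heq, div_self]
      rw [← heq]
      exact norm_ne_zero_iff.2 h0
  obtain ⟨d, rfl⟩ := IsAlgClosed.exists_pow_nat_eq c two_pos
  have hd : ‖d‖ = 1 := by
    rw [norm_pow] at hc
    exact (pow_eq_one_iff_of_nonneg (norm_nonneg d) two_ne_zero).1 hc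
  have hdd : conj d * d = 1 := by rw [mul_comm, mul_conj, normSq_eq_norm_sq, hd]; simp
  have hd0 : d ≠ 0 := norm_ne_zero_iff.1 (hd ▸ one_ne_zero)
  have := hD (d • v)
  rw [map_smul, map_smul, map_smul, smul_eq_mul, smul_eq_mul, map_mul] at this
  have hz : d * g v + conj d * conj (h v) = 0 := by
    linear_combination conj d * hcv - d * g v * hdd
  rw [hz] at this
  exact spectrum.zero_notMem ℂ ((isUnit_smul_iff (Units.mk0 d hd0) (T v)).2 hv) this

theorem norm_deriv_le_of_norm_ne {q r : ℂ → ℂ} {ρ : ℝ} (hρ : 0 < ρ) (hq : Differentiable ℂ q)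
    (hr : Differentiable ℂ r) (hq0 : q 0 = 1) (hr0 : r 0 = 0)
    (hne : ∀ w ∈ Metric.ball (0 : ℂ) ρ, ‖q w‖ ≠ ‖r w‖) : ‖deriv r 0‖ ≤ 1 / ρ := by
  have hmem : (0 : ℂ) ∈ Metric.ball (0 : ℂ) ρ := Metric.mem_ball_self hρ
  have hlt : ∀ w ∈ Metric.ball (0 : ℂ) ρ, ‖r w‖ < ‖q w‖ := by
    intro w hw
    by_contra! hle
    have hconn : IsPreconnected (Metric.ball (0 : ℂ) ρ) := (convex_ball _ _).isPreconnected
    obtain ⟨a, ha, hae⟩ := hconn.intermediate_value₂ hmem hw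
      hr.continuous.norm.continuousOn hq.continuous.norm.continuousOn (by simp [hq0, hr0]) hle
    exact hne a ha hae.symm
  have hq_ne : ∀ w ∈ Metric.ball (0 : ℂ) ρ, q w ≠ 0 := fun w hw ↦
    norm_pos_iff.1 ((norm_nonneg _).trans_lt (hlt w hw))
  have hd : deriv (fun w ↦ r w / q w) 0 = deriv r 0 := by
    rw [deriv_fun_div (hr 0) (hq 0) (hq_ne 0 hmem), hq0, hr0]
    simp
  rw [← hd]
  refine norm_deriv_le_div_of_mapsTo_ball
    (fun w hw ↦ ((hr w).div (hq w) (hq_ne w hw)).differentiableWithinAt) ?_ hρ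
  intro w hw
  simp only [hr0, zero_div, mem_closedBall_zero_iff, norm_div]
  exact div_le_one_of_le₀ (hlt w hw).le (norm_nonneg _)

/-- The evaluation at `x` of polynomials of degree less than `N`, given by their coefficients. -/
noncomputable def powerSum {A : Type*} [Ring A] [Algebra ℂ A] (x : A) (N : ℕ) :
    (Fin N → ℂ) →ₗ[ℂ] A :=
  Fintype.linearCombination ℂ fun i : Fin N ↦ x ^ (i : ℕ)

theorem powerSum_single {A : Type*} [Ring A] [Algebra ℂ A] (x : A) {N : ℕ} (i : Fin N) (c : ℂ) :
    powerSum x N (Pi.single i c) = c • x ^ (i : ℕ) := by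
  simp [powerSum]

/-- The coefficients of `(1 - w X) ^ n`. -/
def oneSubPowCoeff (n : ℕ) (w : ℂ) : Fin (n + 1) → ℂ := fun k ↦ n.choose k * (-w) ^ (k : ℕ)

theorem powerSum_oneSubPowCoeff {A : Type*} [Ring A] [Algebra ℂ A] (x : A) (n : ℕ) (w : ℂ) :
    powerSum x (n + 1) (oneSubPowCoeff n w) = (1 - w • x) ^ n := by
  rw [sub_eq_neg_add, (Commute.one_right (-(w • x))).add_pow, powerSum,
    Fintype.linearCombination_apply]
  refine (Fin.sum_univ_eq_sum_range
    (fun k ↦ ((n.choose k : ℂ) * (-w) ^ k) • x ^ k) (n + 1)).trans ?_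
  refine Finset.sum_congr rfl fun k _ ↦ ?_
  rw [one_pow, mul_one, ← neg_smul, smul_pow, mul_smul, Nat.cast_smul_eq_nsmul, nsmul_eq_mul,
    (Nat.cast_commute _ _).eq]

theorem hasDerivAt_oneSubPowCoeff (n : ℕ) :
    HasDerivAt (oneSubPowCoeff (n + 1)) (Pi.single 1 (-(n + 1 : ℂ))) 0 := by
  rw [hasDerivAt_pi]
  intro k
  have h := (((hasDerivAt_id (0 : ℂ)).neg.pow (k : ℕ)).const_mul ((n + 1).choose k : ℂ))
  refine h.congr_deriv ?_
  rcases eq_or_ne k 1 with rfl | hk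
  · simp
  · rw [Pi.single_eq_of_ne hk]
    rcases Nat.lt_or_ge (k : ℕ) 1 with h0 | h0
    · simp [Nat.lt_one_iff.1 h0]
    · have : (k : ℕ) - 1 ≠ 0 := fun h1 ↦ hk (Fin.ext (by simp; omega))
      simp [this]

theorem norm_dbar_le_of_mem_spectrum {A : Type*} [NormedRing A] [NormedAlgebra ℂ A]
    [CompleteSpace A] (x : A) (n : ℕ) (D : (Fin (n + 2) → ℂ) →ₗ[ℝ] ℂ)
    (hD : ∀ v, D v ∈ spectrum ℂ (powerSum x (n + 2) v)) :
    ‖D (Pi.single 1 1) + I * D (I • Pi.single 1 1)‖ ≤ 2 * (‖x‖ + 1) / (n + 1) := by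
  obtain ⟨g, h, hgh⟩ := exists_add_conj_of_real_linear D
  have hone : ∀ c : ℂ, g (Pi.single 0 c) + conj (h (Pi.single 0 c)) = c := by
    intro c
    have := hD (Pi.single 0 c)
    rw [powerSum_single, Fin.val_zero, pow_zero, ← Algebra.algebraMap_eq_smul_one, hgh] at this
    exact eq_of_mem_spectrum_algebraMap this
  have hI : (Pi.single 0 I : Fin (n + 2) → ℂ) = I • Pi.single 0 1 := by
    rw [← Pi.single_smul, smul_eq_mul, mul_one]
  have h1 := hone 1
  have h2 := hone I
  rw [hI, map_smul, map_smul, smul_eq_mul, smul_eq_mul, map_mul, conj_I] at h2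
  have h3 : g (Pi.single 0 1) - conj (h (Pi.single 0 1)) = 1 := by
    apply mul_left_cancel₀ I_ne_zero
    linear_combination h2
  have hg0 : g (Pi.single 0 1) = 1 := by linear_combination (h1 + h3) / 2
  have hh0 : h (Pi.single 0 1) = 0 := by
    rw [← map_eq_zero (starRingEnd ℂ)]
    linear_combination (h1 - h3) / 2
  have hu0 : oneSubPowCoeff (n + 1) 0 = Pi.single 0 1 := by
    ext k
    rcases eq_or_ne k 0 with rfl | hk
    · simp [oneSubPowCoeff]
    · have : (k : ℕ) ≠ 0 := fun h ↦ hk (Fin.ext h)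
      simp [oneSubPowCoeff, hk, this]
  have hu : Differentiable ℂ (oneSubPowCoeff (n + 1)) := by
    unfold oneSubPowCoeff
    fun_prop
  have hpos : 0 < (‖x‖ + 1)⁻¹ := by positivity
  have hder : deriv (fun w ↦ h (oneSubPowCoeff (n + 1) w)) 0 = -(n + 1) * h (Pi.single 1 1) := by
    have := (h.toContinuousLinearMap.hasFDerivAt.comp_hasDerivAt 0
      (hasDerivAt_oneSubPowCoeff n)).deriv
    have hs : (Pi.single 1 (-(n + 1 : ℂ)) : Fin (n + 2) → ℂ) = (-(n + 1 : ℂ)) • Pi.single 1 1 := by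
      rw [← Pi.single_smul, smul_eq_mul, mul_one]
    rw [hs, map_smul] at this
    exact this
  have key := norm_deriv_le_of_norm_ne (q := fun w ↦ g (oneSubPowCoeff (n + 1) w))
    (r := fun w ↦ h (oneSubPowCoeff (n + 1) w)) hpos
    (g.toContinuousLinearMap.differentiable.comp hu)
    (h.toContinuousLinearMap.differentiable.comp hu)
    (by simp only [hu0, hg0]) (by simp only [hu0, hh0]) (fun w hw ↦ by
      refine norm_ne_norm_of_isUnit (T := powerSum x (n + 2)) (fun v ↦ hgh v ▸ hD v) ?_
      rw [powerSum_oneSubPowCoeff]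
      refine (isUnit_one_sub_of_norm_lt_one ?_).pow _
      rw [norm_smul]
      rw [mem_ball_zero_iff, ← one_div, lt_div_iff₀ (by positivity)] at hw
      linarith [norm_nonneg w])
  rw [hder, norm_mul, norm_neg, one_div, inv_inv] at key
  have hn : ‖(n : ℂ) + 1‖ = n + 1 := by
    rw [← Nat.cast_add_one, norm_natCast, Nat.cast_add_one]
  rw [hn] at key
  have heq : D (Pi.single 1 1) + I * D (I • Pi.single 1 1) = 2 * conj (h (Pi.single 1 1)) := by
    rw [hgh, hgh, map_smul, map_smul, smul_eq_mul, smul_eq_mul, map_mul, conj_I]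
    linear_combination (g (Pi.single 1 1) - conj (h (Pi.single 1 1))) * I_mul_I
  rw [heq, norm_mul, norm_conj, norm_ofNat, le_div_iff₀ (by positivity)]
  linarith

open Polynomial in
theorem exists_eq_prod_one_sub {Q : ℂ[X]} (hQ : Q.coeff 0 = 1) :
    ∃ s : Multiset ℂ, s.card ≤ Q.natDegree ∧ (∀ b ∈ s, b ≠ 0 ∧ Q.eval b⁻¹ = 0) ∧
      Q = (s.map fun b ↦ 1 - C b * X).prod := by
  have hQ0 : Q ≠ 0 := by rintro rfl; simp at hQ
  have hroot : ∀ a ∈ Q.roots, a ≠ 0 := by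
    rintro a ha rfl
    have := (mem_roots hQ0).1 ha
    rw [IsRoot, ← coeff_zero_eq_eval_zero, hQ] at this
    exact one_ne_zero this
  refine ⟨Q.roots.map (·⁻¹), ?_, ?_, ?_⟩
  · rw [Multiset.card_map]
    exact Q.card_roots'
  · intro b hb
    obtain ⟨a, ha, rfl⟩ := Multiset.mem_map.1 hb
    rw [inv_inv]
    exact ⟨inv_ne_zero (hroot a ha), (mem_roots hQ0).1 ha⟩
  · have h := (IsAlgClosed.splits Q).eq_prod_roots
    have h1 : (Q.roots.map fun a ↦ X - C a) =
        Q.roots.map fun a ↦ C (-a) * (1 - C a⁻¹ * X) := by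
      refine Multiset.map_congr rfl fun a ha ↦ ?_
      rw [mul_sub, ← mul_assoc, ← C_mul, neg_mul, mul_inv_cancel₀ (hroot a ha)]
      simp only [C_neg, C_1]
      ring
    rw [h1, Multiset.prod_map_mul, ← mul_assoc] at h
    have h2 : (Q.roots.map fun a ↦ C (-a)).prod = C (Q.roots.map fun a ↦ -a).prod := by
      rw [map_multiset_prod, Multiset.map_map]
      rfl
    rw [h2, ← C_mul] at h
    rw [Multiset.map_map]
    set c := Q.leadingCoeff * (Q.roots.map fun a ↦ -a).prod
    set P := (Q.roots.map fun a ↦ 1 - C a⁻¹ * X).prod with hP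
    have hP0 : P.coeff 0 = 1 := by
      rw [coeff_zero_eq_eval_zero, hP, eval_multiset_prod, Multiset.map_map]
      simp
    have hc : c = 1 := by
      rw [h, coeff_C_mul, hP0, mul_one] at hQ
      exact hQ
    rw [hc, C_1, one_mul] at h
    exact h

open Polynomial in
theorem coeff_prod_one_sub (s : Multiset ℂ) :
    (s.map fun b ↦ 1 - C b * X).prod.coeff 0 = 1 ∧
    (s.map fun b ↦ 1 - C b * X).prod.coeff 1 = -s.sum ∧
    2 * (s.map fun b ↦ 1 - C b * X).prod.coeff 2 = s.sum ^ 2 - (s.map (· ^ 2)).sum := by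
  induction s using Multiset.induction_on with
  | empty => simp [coeff_one]
  | cons b s ih =>
    obtain ⟨h0, h1, h2⟩ := ih
    simp only [Multiset.map_cons, Multiset.prod_cons, Multiset.sum_cons]
    set P := (s.map fun b ↦ 1 - C b * X).prod
    have e : (1 - C b * X) * P = P - C b * (P * X) := by ring
    rw [e]
    simp only [coeff_sub, coeff_C_mul, coeff_mul_X_zero]
    rw [coeff_mul_X P 0, coeff_mul_X P 1, h0, h1]
    exact ⟨by simp, by ring, by linear_combination h2⟩

theorem map_one_of_mem_spectrum {A : Type*} [Ring A] [Algebra ℂ A] {F : A →ₗ[ℂ] ℂ}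
    (hF : ∀ x, F x ∈ spectrum ℂ x) : F 1 = 1 :=
  eq_of_mem_spectrum_algebraMap (A := A) (by rw [map_one]; exact hF 1)

section
variable {A : Type*} [NormedRing A] [NormedAlgebra ℂ A] [CompleteSpace A] {F : A →ₗ[ℂ] ℂ}

open Polynomial in
theorem norm_mul_sq_sub_le (hF : ∀ x, F x ∈ spectrum ℂ x) (x : A) (n : ℕ) :
    ‖(n : ℂ) * (n - 1) * F (x ^ 2) - n ^ 2 * F x ^ 2‖ ≤ n * (‖x‖ * ‖(1 : A)‖) ^ 2 := by
  have hF1 := map_one_of_mem_spectrum hF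
  let Q : ℂ[X] := ∑ k ∈ Finset.range (n + 1), C (n.choose k * (-1) ^ k * F (x ^ k)) * X ^ k
  have hcoeff : ∀ k, Q.coeff k = n.choose k * (-1) ^ k * F (x ^ k) := by
    intro k
    simp only [Q, finsetSum_coeff, coeff_C_mul, coeff_X_pow, mul_ite, mul_one, mul_zero,
      Finset.sum_ite_eq, Finset.mem_range]
    split_ifs with h
    · rfl
    · rw [Nat.choose_eq_zero_of_lt (by omega)]
      simp
  have hdeg : Q.natDegree ≤ n := by
    rw [natDegree_le_iff_coeff_eq_zero]
    intro k hk
    rw [hcoeff, Nat.choose_eq_zero_of_lt hk]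
    simp
  have heval : ∀ w, Q.eval w = F ((1 - w • x) ^ n) := by
    intro w
    rw [sub_eq_neg_add, (Commute.one_right (-(w • x))).add_pow, map_sum, eval_finsetSum]
    refine Finset.sum_congr rfl fun k _ ↦ ?_
    rw [one_pow, mul_one, ← (Nat.cast_commute (n.choose k) _).eq,
      ← nsmul_eq_mul (n.choose k) ((-(w • x)) ^ k), map_nsmul, ← neg_smul, _root_.smul_pow, map_smul,
      nsmul_eq_mul, smul_eq_mul, neg_pow w]
    simp only [eval_mul, eval_C, eval_pow, eval_X]
    ring
  obtain ⟨s, hcard, hs, hQ⟩ := exists_eq_prod_one_sub (Q := Q) (by simp [hcoeff, hF1])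
  obtain ⟨-, h1, h2⟩ := coeff_prod_one_sub s
  rw [← hQ, hcoeff] at h1 h2
  have hb : ∀ b ∈ s, ‖b‖ ≤ ‖x‖ * ‖(1 : A)‖ := by
    intro b hbs
    obtain ⟨hb0, hbe⟩ := hs b hbs
    refine spectrum.norm_le_norm_mul_of_mem (spectrum.mem_iff.2 fun hu ↦ ?_)
    have hm := hF ((1 - b⁻¹ • x) ^ n)
    rw [← heval, hbe] at hm
    refine spectrum.zero_notMem ℂ (IsUnit.pow n ?_) hm
    have := (isUnit_smul_iff (Units.mk0 b⁻¹ (inv_ne_zero hb0)) _).2 hu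
    rwa [Units.smul_mk0, smul_sub, Algebra.algebraMap_eq_smul_one, smul_smul,
      inv_mul_cancel₀ hb0, one_smul] at this
  have hchoose : (2 : ℂ) * n.choose 2 = n * (n - 1) := by
    rw [Nat.cast_choose_two]
    ring
  have hsum : (n : ℂ) * (n - 1) * F (x ^ 2) - n ^ 2 * F x ^ 2 = -(s.map (· ^ 2)).sum := by
    rw [Nat.choose_one_right, pow_one, pow_one] at h1
    have h1' : s.sum = n * F x := by linear_combination h1
    rw [h1'] at h2
    linear_combination h2 - F (x ^ 2) * hchoose
  rw [hsum, norm_neg]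
  refine (norm_multiset_sum_le _).trans ?_
  rw [Multiset.map_map]
  refine (Multiset.sum_le_card_nsmul _ ((‖x‖ * ‖(1 : A)‖) ^ 2) ?_).trans ?_
  · intro r hr
    obtain ⟨b, hbs, rfl⟩ := Multiset.mem_map.1 hr
    simp only [Function.comp_apply, norm_pow]
    exact pow_le_pow_left₀ (norm_nonneg _) (hb b hbs) 2
  · rw [Multiset.card_map, nsmul_eq_mul]
    gcongr
    exact hcard.trans hdeg

theorem map_sq_of_mem_spectrum (hF : ∀ x, F x ∈ spectrum ℂ x) (x : A) : F (x ^ 2) = F x ^ 2 := by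
  rw [← sub_eq_zero, ← norm_eq_zero]
  set M := (‖x‖ * ‖(1 : A)‖) ^ 2 + ‖F (x ^ 2)‖
  refine le_antisymm (ge_of_tendsto (tendsto_const_div_atTop_nhds_zero_nat M) ?_) (norm_nonneg _)
  filter_upwards [eventually_gt_atTop 0] with n hn
  have hn' : (0 : ℝ) < n := Nat.cast_pos.2 hn
  rw [le_div_iff₀ hn']
  have key := norm_mul_sq_sub_le hF x n
  have e : (n : ℂ) * (n - 1) * F (x ^ 2) - n ^ 2 * F x ^ 2 =
    n * (n * (F (x ^ 2) - F x ^ 2) - F (x ^ 2)) := by ring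
  rw [e, norm_mul, norm_natCast] at key
  have key' := le_of_mul_le_mul_left key hn'
  have h3 := norm_sub_norm_le ((n : ℂ) * (F (x ^ 2) - F x ^ 2)) (F (x ^ 2))
  rw [norm_mul, norm_natCast] at h3
  linarith

/-- The **Gleason–Kahane–Żelazko theorem**. -/
theorem map_mul_of_mem_spectrum (hF : ∀ x, F x ∈ spectrum ℂ x) (x y : A) :
    F (x * y) = F x * F y := by
  have hF1 := map_one_of_mem_spectrum hF
  have hsq := map_sq_of_mem_spectrum hF
  have hjordan : ∀ a b, F (a * b) + F (b * a) = 2 * F a * F b := by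
    intro a b
    have h := hsq (a + b)
    rw [show (a + b) ^ 2 = a ^ 2 + b ^ 2 + (a * b + b * a) by noncomm_ring, map_add, map_add,
      map_add, map_add, hsq, hsq] at h
    linear_combination h
  have hzero : ∀ a b, F a = 0 → F (a * b) = 0 := by
    intro a b ha
    have h1 := hsq (a * b - b * a)
    have h2 := hsq (a * b + b * a)
    have h3 := hjordan a (b * a * b)
    have h4 := hjordan a b
    have h5 : (a * b - b * a) ^ 2 + (a * b + b * a) ^ 2 =
        (2 : ℂ) • (a * (b * a * b) + b * a * b * a) := by
      rw [ofNat_smul_eq_nsmul]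
      noncomm_ring
    have h6 := congrArg F h5
    rw [map_smul, map_add, map_add, h1, h2, map_sub, map_add, smul_eq_mul, h3, h4, ha] at h6
    have h7 : F (a * b) - F (b * a) = 0 := by
      rw [← sq_eq_zero_iff]
      linear_combination h6
    rw [ha] at h4
    linear_combination (h4 + h7) / 2
  have h := hzero (x - F x • 1) y (by rw [map_sub, map_smul, hF1]; simp)
  rw [sub_mul, map_sub, smul_mul_assoc, one_mul, map_smul, smul_eq_mul] at h
  exact sub_eq_zero.1 h
end

section
variable {A : Type*} [NormedRing A] [NormedAlgebra ℂ A] [CompleteSpace A] {φ : A → ℂ}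

theorem lipschitzWith_of_sub_mem_spectrum (hφ : ∀ x y, φ x - φ y ∈ spectrum ℂ (x - y)) :
    LipschitzWith ‖(1 : A)‖₊ φ :=
  LipschitzWith.of_dist_le_mul fun x y ↦ by
    rw [dist_eq_norm, dist_eq_norm, mul_comm]
    exact spectrum.norm_le_norm_mul_of_mem (hφ x y)

theorem fderiv_comp_mem_spectrum {E : Type*} [NormedAddCommGroup E] [NormedSpace ℂ E]
    (hφ : ∀ x y, φ x - φ y ∈ spectrum ℂ (x - y)) (T : E →ₗ[ℂ] A) {p : E}
    (hp : DifferentiableAt ℝ (φ ∘ T) p) (v : E) :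
    fderiv ℝ (φ ∘ T) p v ∈ spectrum ℂ (T v) := by
  have hlim := (hp.hasFDerivAt.hasLineDerivAt v).tendsto_slope_zero
  refine (spectrum.isClosed (T v)).mem_of_tendsto hlim ?_
  filter_upwards [self_mem_nhdsWithin] with t (ht : t ≠ 0)
  have ht' : (t : ℂ) ≠ 0 := ofReal_ne_zero.2 ht
  have h := hφ (T (p + t • v)) (T p)
  have hT : T (p + t • v) - T p = Units.mk0 (t : ℂ) ht' • T v := by
    rw [← map_sub, add_sub_cancel_left, Units.smul_mk0, ← map_smul, coe_smul]
  rw [hT] at h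
  refine (spectrum.smul_mem_smul_iff (r := Units.mk0 (t : ℂ) ht')).1 ?_
  convert h using 1
  rw [Units.smul_mk0, coe_smul, smul_smul, mul_inv_cancel₀ ht, one_smul]
  rfl

theorem differentiable_comp_smul (hφ : ∀ x y, φ x - φ y ∈ spectrum ℂ (x - y)) (x : A) :
    Differentiable ℂ fun t : ℂ ↦ φ (t • x) := by
  have hLip := lipschitzWith_of_sub_mem_spectrum hφ
  have hcont : Continuous fun t : ℂ ↦ φ (t • x) := hLip.continuous.comp (by fun_prop)
  rw [← differentiableOn_univ, ←
    isConservativeOn_and_continuousOn_iff_isDifferentiableOn isOpen_univ]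
  refine ⟨fun z w _ ↦ ?_, hcont.continuousOn⟩
  rw [← add_eq_zero_iff_eq_neg, ← norm_eq_zero]
  have hlim : Tendsto (fun n : ℕ ↦ 2 * (‖x‖ + 1) / ((n : ℝ) + 1) * |w.im - z.im| * |w.re - z.re|)
      atTop (𝓝 0) := by
    have := ((tendsto_const_div_atTop_nhds_zero_nat (2 * (‖x‖ + 1))).comp
      (tendsto_add_atTop_nat 1)).mul_const (|w.im - z.im| * |w.re - z.re|)
    rw [zero_mul] at this
    refine this.congr fun n ↦ ?_
    simp [mul_assoc]
  refine le_antisymm (ge_of_tendsto' hlim fun n ↦ ?_) (norm_nonneg _)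
  let T := powerSum x (n + 2)
  have hT : ∀ t : ℂ, T (t • Pi.single 1 1) = t • x := fun t ↦ by
    simp [T, powerSum_single]
  have hF : LipschitzWith _ (φ ∘ T) := hLip.comp T.toContinuousLinearMap.lipschitz
  have h := norm_wedgeIntegral_add_le_of_lipschitz hF (e := Pi.single 1 1)
    (ε := 2 * (‖x‖ + 1) / (n + 1)) (fun p hp ↦ norm_dbar_le_of_mem_spectrum x n
      (fderiv ℝ (φ ∘ T) p).toLinearMap (fderiv_comp_mem_spectrum hφ T hp)) z w
  simpa only [Function.comp_apply, hT] using h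

theorem map_smul_of_sub_mem_spectrum (h0 : φ 0 = 0)
    (hφ : ∀ x y, φ x - φ y ∈ spectrum ℂ (x - y)) (t : ℂ) (x : A) : φ (t • x) = t * φ x := by
  have hd := differentiable_comp_smul hφ x
  set f : ℂ → ℂ := fun t ↦ φ (t • x) with hf
  have hLip : LipschitzWith (‖(1 : A)‖₊ * ‖x‖₊) f :=
    (lipschitzWith_of_sub_mem_spectrum hφ).comp (LipschitzWith.of_dist_le_mul fun s t ↦ by
      rw [dist_eq_norm, ← sub_smul, norm_smul, mul_comm, dist_eq_norm]
      rfl)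
  have hbdd : Bornology.IsBounded (Set.range (deriv f)) :=
    isBounded_iff_forall_norm_le.2 ⟨_, by
      rintro _ ⟨t, rfl⟩
      exact norm_deriv_le_of_lipschitz hLip⟩
  have hconst : ∀ t, deriv f t = deriv f 0 := fun t ↦
    hd.deriv.apply_eq_apply_of_bounded hbdd t 0
  have hlin : ∀ t, f t - t * deriv f 0 = 0 := by
    intro t
    have hg : ∀ s, HasDerivAt (fun s ↦ f s - s * deriv f 0) 0 s := fun s ↦ by
      refine ((hd s).hasDerivAt.sub ((hasDerivAt_id s).mul_const (deriv f 0))).congr_deriv ?_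
      rw [hconst s, one_mul, sub_self]
    rw [is_const_of_deriv_eq_zero (fun s ↦ (hg s).differentiableAt) (fun s ↦ (hg s).deriv) t 0]
    simp [hf, h0]
  have h1 := hlin 1
  have ht := hlin t
  simp only [hf, one_smul] at h1 ht
  linear_combination ht - t * h1

theorem map_add_of_sub_mem_spectrum (h0 : φ 0 = 0)
    (hφ : ∀ x y, φ x - φ y ∈ spectrum ℂ (x - y)) (x y : A) : φ (x + y) = φ x + φ y := by
  have htrans : ∀ (a b : A) (t : ℂ), φ (a + t • b) - φ a = t * (φ (a + b) - φ a) := by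
    intro a b t
    refine map_smul_of_sub_mem_spectrum (φ := fun b ↦ φ (a + b) - φ a) (by simp) ?_ t b
    intro u v
    simpa using hφ (a + u) (a + v)
  have h1 := htrans x y 2
  have h2 := htrans y x 2⁻¹
  have h3 := map_smul_of_sub_mem_spectrum h0 hφ 2 (y + (2⁻¹ : ℂ) • x)
  rw [smul_add, smul_smul, mul_inv_cancel₀ two_ne_zero, one_smul, add_comm] at h3
  rw [add_comm y x] at h2
  linear_combination h3 - h1 + 2 * h2

theorem map_mem_spectrum_of_isCharacter {A : Type*} [Ring A] [Algebra ℂ A] {ψ : A → ℂ}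
    (hψ : IsCharacter ψ) (x : A) : ψ x ∈ spectrum ℂ x := by
  obtain ⟨hne, hlin, hmul⟩ := hψ
  obtain ⟨z, hz⟩ := Function.ne_iff.1 hne
  have h1 : ψ 1 = 1 := by
    have := hmul z 1
    rw [mul_one] at this
    exact (mul_eq_left₀ hz).1 this.symm
  intro hu
  obtain ⟨u, hu⟩ := spectrum.mem_resolventSet_iff.1 hu
  have := hmul u ↑u⁻¹
  rw [Units.mul_inv, h1, hu, hlin.map_sub, Algebra.algebraMap_eq_smul_one, hlin.map_smul,
    h1] at this
  simp at this

end

end KowalskiSlodkowski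

open KowalskiSlodkowski

/-- The Kowalski–Słodkowski theorem. -/
theorem stmt_14 {A : Type*} [NormedRing A] [NormedAlgebra ℂ A] [CompleteSpace A]
    (φ : A → ℂ) :
    IsCharacter φ ↔ (φ 0 = 0 ∧ ∀ x y : A, φ x - φ y ∈ spectrum ℂ (x - y)) := by
  constructor
  · intro h
    refine ⟨h.2.1.map_zero, fun x y ↦ ?_⟩
    rw [← h.2.1.map_sub]
    exact map_mem_spectrum_of_isCharacter h _
  · rintro ⟨h0, hφ⟩
    let F : A →ₗ[ℂ] ℂ :=
      { toFun := φ
        map_add' := map_add_of_sub_mem_spectrum h0 hφ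
        map_smul' := map_smul_of_sub_mem_spectrum h0 hφ }
    have hF : ∀ x, F x ∈ spectrum ℂ x := fun x ↦ by
      have := hφ x 0
      rwa [h0, sub_zero, sub_zero] at this
    refine ⟨?_, F.isLinear, map_mul_of_mem_spectrum hF⟩
    rintro rfl
    exact zero_ne_one (map_one_of_mem_spectrum hF)
end

section
/- (Maouche) Let A be a complex unital Banach algebra and let φ : A → ℂ be a multiplicative function (φ(x·y) = φ(x)·φ(y) for all x, y) satisfying φ(x) ∈ σ(x) for each x ∈ A. Then there exists a unique character ψ of A such that ψ(u) = φ(u) for every u in G₁(A), the connected component of the identity in the group G(A) of invertible elements of A. -/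
open scoped ComplexConjugate

section ComplexAnalysis

open Filter Topology Complex

theorem additive_char_hasDerivAt {c : ℝ → ℂ} (hc : Continuous c) (h0 : c 0 = 1)
    (hadd : ∀ s t, c (s + t) = c s * c t) (t : ℝ) : HasDerivAt c (c t * deriv c 0) t := by
  have hint : ∀ a b, IntervalIntegrable c MeasureTheory.volume a b :=
    fun a b => hc.intervalIntegrable a b
  have hG : ∀ u, HasDerivAt (fun v => ∫ s in (0 : ℝ)..v, c s) (c u) u := fun u =>
    hc.integral_hasStrictDerivAt 0 u |>.hasDerivAt
  obtain ⟨δ, hδ⟩ : ∃ δ : ℝ, ∫ s in (0 : ℝ)..δ, c s ≠ 0 := by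
    by_contra! h
    have h1 := hG 0
    simp only [h, h0] at h1
    exact one_ne_zero (h1.unique (hasDerivAt_const 0 (0 : ℂ)))
  have hd0 : DifferentiableAt ℝ c 0 := by
    have key : c = fun t => ((∫ s in (0 : ℝ)..(t + δ), c s) - ∫ s in (0 : ℝ)..t, c s) /
        ∫ s in (0 : ℝ)..δ, c s := by
      funext t
      rw [eq_div_iff hδ, intervalIntegral.integral_interval_sub_left (hint _ _) (hint _ _),
        ← intervalIntegral.integral_const_mul]
      simp_rw [← hadd]
      rw [intervalIntegral.integral_comp_add_left (fun s => c s)]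
      simp
    rw [key]
    exact ((((hG (0 + δ)).comp_add_const 0 δ).sub (hG 0)).div_const _).differentiableAt
  have h2 : HasDerivAt (fun s => c t * c (s - t)) (c t * deriv c 0) t := by
    have h3 : HasDerivAt c (deriv c 0) (t - t) := by simpa using hd0.hasDerivAt
    exact (h3.comp_sub_const t t).const_mul (c t)
  simpa [← hadd] using h2

theorem additive_char_eq_exp {c : ℝ → ℂ} (hc : Continuous c) (h0 : c 0 = 1)
    (hadd : ∀ s t, c (s + t) = c s * c t) : c 1 = Complex.exp (deriv c 0) := by
  set α := deriv c 0
  have hd : ∀ t : ℝ, HasDerivAt (fun t : ℝ => c t * Complex.exp (-(t * α))) 0 t := by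
    intro t
    have h1 : HasDerivAt (fun t : ℝ => Complex.exp (-(t * α)))
        (Complex.exp (-(t * α)) * (-(1 * α))) t :=
      ((Complex.ofRealCLM.hasDerivAt (x := t)).mul_const α).neg.cexp
    refine ((additive_char_hasDerivAt hc h0 hadd t).mul h1).congr_deriv ?_
    ring
  have h := is_const_of_deriv_eq_zero (fun t => (hd t).differentiableAt)
    (fun t => (hd t).deriv) 1 0
  simp only [ofReal_one, one_mul, ofReal_zero, zero_mul, neg_zero, Complex.exp_zero, h0,
    mul_one, Complex.exp_neg] at h
  exact (mul_inv_eq_one₀ (Complex.exp_ne_zero α)).mp h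

theorem iteratedDeriv_two_eq_zero_of_re_le {f : ℂ → ℂ} (hf : Differentiable ℂ f) (h0 : f 0 = 0)
    {C D : ℝ} (hC : 0 < C) (hD : 0 ≤ D) (hre : ∀ z, (f z).re ≤ C + D * ‖z‖) :
    iteratedDeriv 2 f 0 = 0 := by
  have hb : ∀ r : ℝ, 0 < r → ‖iteratedDeriv 2 f 0‖ ≤
      4 * (C * r⁻¹ + 2 * D) * r⁻¹ := by
    intro r hr
    have hs : ∀ z ∈ Metric.sphere (0 : ℂ) r, ‖f z‖ ≤ 2 * (C + D * (2 * r)) := by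
      intro z hz
      have hz' : ‖z‖ = r := by simpa using hz
      have := Complex.borelCaratheodory_zero (f := f) (R := 2 * r) (M := C + D * (2 * r)) (z := z)
        (by positivity) hf.differentiableOn ?_ (by positivity) (by simp [hz']; linarith) h0
      · rw [hz'] at this
        convert this using 1
        field_simp
        ring
      · intro w hw
        have hw' : ‖w‖ < 2 * r := by simpa using hw
        exact (hre w).trans (by gcongr)
    have := Complex.norm_iteratedDeriv_le_of_forall_mem_sphere_norm_le 2 hr hf.diffContOnCl hs
    refine this.trans (le_of_eq ?_)
    simp [Nat.factorial]
    field_simp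
    ring
  have hlim : Tendsto (fun r : ℝ => 4 * (C * r⁻¹ + 2 * D) * r⁻¹) atTop (𝓝 0) := by
    have hi := tendsto_inv_atTop_zero (𝕜 := ℝ)
    simpa using (((hi.const_mul C).add_const (2 * D)).const_mul 4).mul hi
  have := ge_of_tendsto hlim ((eventually_gt_atTop 0).mono hb)
  simpa using this

theorem deriv_deriv_eq_sq_of_ne_zero {g : ℂ → ℂ} (hg : Differentiable ℂ g) (h0 : g 0 = 1)
    (hne : ∀ z, g z ≠ 0) {C D : ℝ} (hD : 0 ≤ D) (hb : ∀ z, ‖g z‖ ≤ C * Real.exp (D * ‖z‖)) :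
    deriv (deriv g) 0 = deriv g 0 ^ 2 := by
  have hdg : Differentiable ℂ (deriv g) := hg.deriv
  have hq : Differentiable ℂ (fun z => deriv g z / g z) := hdg.div hg hne
  obtain ⟨k, hk0, hk⟩ : ∃ k : ℂ → ℂ, k 0 = 0 ∧ ∀ z, HasDerivAt k (deriv g z / g z) z := by
    obtain ⟨k, hk⟩ := hq.isExactOn_univ
    refine ⟨fun z => k z - k 0, by simp, fun z => ?_⟩
    exact (hk z trivial).sub_const _
  have hexp : ∀ z, g z = Complex.exp (k z) := by
    have hd : ∀ z, HasDerivAt (fun z => g z * Complex.exp (-k z)) 0 z := by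
      intro z
      refine ((hg z).hasDerivAt.mul (hk z).neg.cexp).congr_deriv ?_
      have := hne z
      field_simp
      ring
    intro z
    have h := is_const_of_deriv_eq_zero (fun t => (hd t).differentiableAt)
      (fun t => (hd t).deriv) z 0
    simp only [hk0, h0, neg_zero, Complex.exp_zero, mul_one, Complex.exp_neg] at h
    exact (mul_inv_eq_one₀ (Complex.exp_ne_zero _)).mp h
  have hC : 1 ≤ C := by simpa [h0] using hb 0
  have hre : ∀ z, (k z).re ≤ (Real.log C + 1) + D * ‖z‖ := by
    intro z
    have h1 := hb z
    rw [hexp, Complex.norm_exp, ← Real.exp_log (by linarith : 0 < C), ← Real.exp_add,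
      Real.exp_le_exp] at h1
    linarith
  have h2 := iteratedDeriv_two_eq_zero_of_re_le (fun z => (hk z).differentiableAt) hk0
    (by linarith [Real.log_nonneg hC]) hD hre
  have hdk : deriv k = fun z => deriv g z / g z := funext fun z => (hk z).deriv
  rw [iteratedDeriv_succ, iteratedDeriv_one, hdk, deriv_fun_div (hdg 0) (hg 0) (hne 0), h0] at h2
  linear_combination h2

end ComplexAnalysis

section BanachAlgebra

open Filter Topology

variable {A : Type*} [NormedRing A] [NormedAlgebra ℂ A] [CompleteSpace A]

theorem isUnit_exp_banach (x : A) : IsUnit (NormedSpace.exp x) :=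
  let := NormedAlgebra.restrictScalars ℚ ℂ A
  NormedSpace.isUnit_exp x

theorem exp_add_smul_banach {𝕜 : Type*} [RCLike 𝕜] [NormedAlgebra 𝕜 A] (s t : 𝕜) (x : A) :
    NormedSpace.exp ((s + t) • x) = NormedSpace.exp (s • x) * NormedSpace.exp (t • x) := by
  let := NormedAlgebra.restrictScalars ℚ ℂ A
  rw [add_smul]
  exact NormedSpace.exp_add_of_commute (((Commute.refl x).smul_left s).smul_right t)

omit [CompleteSpace A] in
theorem norm_exp_le_banach [Nontrivial A] (x : A) : ‖NormedSpace.exp x‖ ≤ ‖(1 : A)‖ * Real.exp ‖x‖ := by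
  have h1 : 1 ≤ ‖(1 : A)‖ := one_le_norm_one A
  rw [congrFun (NormedSpace.exp_eq_tsum ℂ (𝔸 := A)) x, Real.exp_eq_exp_ℝ]
  refine tsum_of_norm_bounded ((NormedSpace.exp_series_hasSum_exp' (𝕂 := ℝ) ‖x‖).mul_left _) ?_
  intro n
  have hn : ‖x ^ n‖ ≤ ‖(1 : A)‖ * ‖x‖ ^ n := by
    rcases Nat.eq_zero_or_pos n with rfl | hn
    · simp
    · exact (norm_pow_le' x hn).trans (le_mul_of_one_le_left (by positivity) h1)
  rw [norm_smul, norm_inv, Complex.norm_natCast, smul_eq_mul, mul_left_comm]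
  gcongr

/-- The Gleason–Kahane–Żelazko argument: a unital functional which does not vanish on exponentials
preserves squares. -/
theorem ContinuousLinearMap.map_mul_self_of_exp_ne_zero (F : A →L[ℂ] ℂ) (h1 : F 1 = 1)
    (hne : ∀ x, F (NormedSpace.exp x) ≠ 0) (x : A) : F (x * x) = F x ^ 2 := by
  have : Nontrivial A := by
    refine ⟨1, 0, fun h => ?_⟩
    rw [h, map_zero] at h1
    exact zero_ne_one h1
  have hd : ∀ y z, HasDerivAt (fun z : ℂ => F (y * NormedSpace.exp (z • x))) (F (y * x * NormedSpace.exp (z • x))) z := by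
    intro y z
    rw [mul_assoc]
    exact F.hasFDerivAt.comp_hasDerivAt z ((hasDerivAt_exp_smul_const' x z).const_mul y)
  have hd1 : deriv (fun z : ℂ => F (1 * NormedSpace.exp (z • x))) = fun z => F (x * NormedSpace.exp (z • x)) := by
    funext z; simpa using (hd 1 z).deriv
  have h := deriv_deriv_eq_sq_of_ne_zero (g := fun z : ℂ => F (1 * NormedSpace.exp (z • x)))
    (fun z => (hd 1 z).differentiableAt) (by simp [h1]) (fun z => by simpa using hne _)
    (C := ‖F‖ * ‖(1 : A)‖) (D := ‖x‖) (norm_nonneg _) (fun z => by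
      rw [one_mul, mul_assoc]
      refine (F.le_opNorm _).trans ?_
      gcongr
      simpa [norm_smul, mul_comm] using norm_exp_le_banach (z • x))
  rw [hd1, (hd x 0).deriv] at h
  simpa using h

theorem exists_ne_zero_mul_add_conj_eq_zero {z w : ℂ} (h : ‖z‖ = ‖w‖) :
    ∃ c : ℂ, c ≠ 0 ∧ c * z + conj c * conj w = 0 := by
  by_cases hz : z = 0
  · have hw : w = 0 := by simpa [hz, eq_comm] using h
    exact ⟨1, one_ne_zero, by simp [hz, hw]⟩
  obtain ⟨c, hc⟩ := IsAlgClosed.exists_pow_nat_eq (-conj w / z) (n := 2) two_pos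
  have hn : ‖c‖ = 1 := by
    have : ‖c‖ ^ 2 = 1 := by
      rw [← norm_pow, hc, norm_div, norm_neg, RCLike.norm_conj, h, div_self]
      rwa [← h, norm_ne_zero_iff]
    exact (pow_eq_one_iff_of_nonneg (norm_nonneg c) two_ne_zero).mp this
  have hcc : c * conj c = 1 := by rw [Complex.mul_conj']; simp [hn]
  refine ⟨c, left_ne_zero_of_mul_eq_one hcc, ?_⟩
  have h2 : c ^ 2 * z = -conj w := by rw [hc]; field_simp
  linear_combination conj c * h2 - c * z * hcc

/-- Kowalski–Słodkowski: a real-linear functional with values in the spectrum is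
complex-linear. -/
theorem ContinuousLinearMap.map_I_smul_of_mem_spectrum (f : A →L[ℝ] ℂ)
    (hf : ∀ x, f x ∈ spectrum ℂ x) (x : A) : f (Complex.I • x) = Complex.I * f x := by
  have hnt : Nontrivial A := by
    by_contra h
    rw [not_nontrivial_iff_subsingleton] at h
    simpa using hf 0
  have hI : ∀ x : A, Complex.I • Complex.I • x = -x := fun x => by simp [smul_smul]
  have hsmul : ∀ (c : ℂ) (x : A),
      f (c • x) = c.re * f x + c.im * f (Complex.I • x) := by
    intro c x
    conv_lhs => rw [← Complex.re_add_im c, add_smul, mul_smul]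
    rw [Complex.coe_smul, Complex.coe_smul, map_add, map_smul, map_smul]
    simp
  let a : A →L[ℂ] ℂ :=
    { toFun := fun x => (f x - Complex.I * f (Complex.I • x)) / 2
      map_add' := fun x y => by simp only [smul_add, map_add]; ring
      map_smul' := fun c x => by
        rw [smul_comm Complex.I c x, hsmul c x, hsmul c (Complex.I • x), hI, map_neg, RingHom.id_apply, smul_eq_mul]
        nth_rw 5 [← Complex.re_add_im c]
        linear_combination ((c.im * f (Complex.I • x)) / 2) * Complex.I_mul_I
      cont := by fun_prop }
  let b : A →L[ℂ] ℂ :=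
    { toFun := fun x => conj ((f x + Complex.I * f (Complex.I • x)) / 2)
      map_add' := fun x y => by
        rw [← map_add]; congr 1; simp only [smul_add, map_add]; ring
      map_smul' := fun c x => by
        rw [smul_comm Complex.I c x, hsmul c x, hsmul c (Complex.I • x), hI, map_neg, RingHom.id_apply, smul_eq_mul]
        rw [← Complex.conj_conj c, ← map_mul, Complex.conj_conj]
        congr 1
        have hc : conj c = c.re - c.im * Complex.I := by apply Complex.ext <;> simp
        rw [hc]
        linear_combination ((c.im * f (Complex.I • x)) / 2) * Complex.I_mul_I
      cont := Complex.continuous_conj.comp (by fun_prop) }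
  have ha : ∀ x, a x = (f x - Complex.I * f (Complex.I • x)) / 2 := fun _ => rfl
  have hb : ∀ x, conj (b x) = (f x + Complex.I * f (Complex.I • x)) / 2 :=
    fun _ => Complex.conj_conj _
  have hfab : ∀ x, f x = a x + conj (b x) := fun x => by rw [ha, hb]; ring
  have hscalar : ∀ c : ℂ, f (c • (1 : A)) = c := by
    intro c
    have := hf (c • (1 : A))
    rwa [← Algebra.algebraMap_eq_smul_one, spectrum.scalar_eq, Algebra.algebraMap_eq_smul_one] at this
  have hf1 : f 1 = 1 := by simpa using hscalar 1
  have ha1 : a 1 = 1 := by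
    rw [ha, hf1, hscalar, Complex.I_mul_I]; norm_num
  have hb1 : b 1 = 0 := by
    rw [← map_eq_zero conj, hb, hf1, hscalar, Complex.I_mul_I]; norm_num
  have hne : ∀ u : A, IsUnit u → ‖b u‖ ≠ ‖a u‖ := by
    intro u hu h
    obtain ⟨c, hc0, hc⟩ := exists_ne_zero_mul_add_conj_eq_zero h.symm
    have h0 : f (c • u) = 0 := by
      rw [hfab, map_smul, map_smul, smul_eq_mul, smul_eq_mul, map_mul, hc]
    have hspec := hf (c • u)
    rw [h0, spectrum.zero_mem_iff] at hspec
    exact hspec (hu.smul (Units.mk0 c hc0))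
  have hlt : ∀ y : A, ‖b (NormedSpace.exp y)‖ < ‖a (NormedSpace.exp y)‖ := by
    intro y
    by_contra! hge
    have hc : Continuous fun t : ℝ => NormedSpace.exp (t • y) :=
      (differentiable_exp_smul_const ℝ y).continuous
    obtain ⟨t, -, ht⟩ := intermediate_value_Icc (zero_le_one (α := ℝ))
      (f := fun t : ℝ => ‖b (NormedSpace.exp (t • y))‖ - ‖a (NormedSpace.exp (t • y))‖)
      (by fun_prop) (show (0 : ℝ) ∈ Set.Icc _ _ by simp [ha1, hb1, hge])
    exact hne _ (isUnit_exp_banach _) (sub_eq_zero.mp ht)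
  have hane : ∀ y : A, a (NormedSpace.exp y) ≠ 0 := fun y =>
    norm_pos_iff.mp ((norm_nonneg _).trans_lt (hlt y))
  have hd : ∀ (F : A →L[ℂ] ℂ) (z : ℂ),
      HasDerivAt (fun z : ℂ => F (NormedSpace.exp (z • x))) (F (NormedSpace.exp (z • x) * x)) z :=
    fun F z => F.hasFDerivAt.comp_hasDerivAt z (hasDerivAt_exp_smul_const x z)
  have hbz : ∀ z : ℂ, b (NormedSpace.exp (z • x)) = 0 := by
    intro z
    have h := Differentiable.apply_eq_apply_of_bounded
      (f := fun z : ℂ => b (NormedSpace.exp (z • x)) / a (NormedSpace.exp (z • x)))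
      (fun z => ((hd b z).differentiableAt.div (hd a z).differentiableAt (hane _)))
      (isBounded_iff_forall_norm_le.mpr ⟨1, by
        rintro _ ⟨w, rfl⟩
        rw [norm_div]
        exact div_le_one_of_le₀ (hlt _).le (norm_nonneg _)⟩) z 0
    simpa [hb1, hane] using h
  have hbx : b x = 0 := by
    have h := hd b 0
    simp only [hbz] at h
    simpa using h.unique (hasDerivAt_const 0 0)
  have := hb x
  rw [hbx, map_zero] at this
  linear_combination (2 * Complex.I) * this + f (Complex.I • x) * Complex.I_mul_I

omit [CompleteSpace A] in
/-- A continuous real-linear functional commuting with multiplication by `I` is complex-linear. -/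
theorem ContinuousLinearMap.exists_complex_of_map_I_smul (f : A →L[ℝ] ℂ)
    (hI : ∀ x, f (Complex.I • x) = Complex.I * f x) : ∃ F : A →L[ℂ] ℂ, ∀ x, F x = f x :=
  ⟨{ toFun := f
     map_add' := map_add f
     map_smul' := fun c x => by
        conv_lhs => rw [← Complex.re_add_im c, add_smul, mul_smul]
        rw [Complex.coe_smul, Complex.coe_smul, map_add, map_smul, map_smul, hI,
          RingHom.id_apply, smul_eq_mul]
        conv_rhs => rw [← Complex.re_add_im c]
        simp only [Complex.real_smul]
        ring
     cont := f.continuous }, fun _ => rfl⟩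

omit [CompleteSpace A] in
theorem map_one_of_mem_spectrum {φ : A → ℂ} (hspec : ∀ x, φ x ∈ spectrum ℂ x) : φ 1 = 1 := by
  have : Nontrivial A := by
    by_contra h
    rw [not_nontrivial_iff_subsingleton] at h
    simpa using hspec 0
  simpa [spectrum.one_eq] using hspec 1

omit [CompleteSpace A] in
theorem ne_zero_of_isUnit_of_mem_spectrum {φ : A → ℂ} (hspec : ∀ x, φ x ∈ spectrum ℂ x) {u : A}
    (hu : IsUnit u) : φ u ≠ 0 := by
  intro h
  have := hspec u
  rw [h, spectrum.zero_mem_iff] at this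
  exact this hu

theorem norm_sub_one_le_of_mem_spectrum {φ : A → ℂ} (hspec : ∀ x, φ x ∈ spectrum ℂ x) (u : A) :
    ‖φ u - 1‖ ≤ ‖u - 1‖ * ‖(1 : A)‖ := by
  refine spectrum.norm_le_norm_mul_of_mem (𝕜 := ℂ) ?_
  have := hspec u
  rw [spectrum.mem_iff] at this ⊢
  rwa [map_sub, map_one, sub_sub_sub_cancel_right]

/-- The derivative at `0` of `φ` along the one-parameter group generated by `x`. -/
noncomputable def expDeriv (φ : A → ℂ) (x : A) : ℂ :=
  deriv (fun t : ℝ => φ (NormedSpace.exp (t • x))) 0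

theorem map_exp_smul_add {φ : A → ℂ} (hmul : ∀ x y, φ (x * y) = φ x * φ y) (x : A) (s t : ℝ) :
    φ (NormedSpace.exp ((s + t) • x)) =
      φ (NormedSpace.exp (s • x)) * φ (NormedSpace.exp (t • x)) := by
  rw [exp_add_smul_banach, hmul]

theorem continuous_map_exp_smul {φ : A → ℂ} (hmul : ∀ x y, φ (x * y) = φ x * φ y)
    (hspec : ∀ x, φ x ∈ spectrum ℂ x) (x : A) :
    Continuous fun t : ℝ => φ (NormedSpace.exp (t • x)) := by
  have he : Continuous fun t : ℝ => NormedSpace.exp (t • x) :=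
    (differentiable_exp_smul_const ℝ x).continuous
  have h0 : Tendsto (fun t : ℝ => φ (NormedSpace.exp (t • x))) (𝓝 0) (𝓝 1) := by
    rw [tendsto_iff_norm_sub_tendsto_zero]
    refine squeeze_zero (fun _ => norm_nonneg _)
      (fun t => norm_sub_one_le_of_mem_spectrum hspec (NormedSpace.exp (t • x))) ?_
    have h : Continuous fun t : ℝ => ‖NormedSpace.exp (t • x) - 1‖ * ‖(1 : A)‖ := by fun_prop
    simpa using h.tendsto 0
  refine continuous_iff_continuousAt.mpr fun s => ?_
  have hs : Tendsto (fun t : ℝ => t - s) (𝓝 s) (𝓝 0) := by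
    have h : Continuous fun t : ℝ => t - s := by fun_prop
    simpa using h.tendsto s
  have h := (h0.comp hs).const_mul (φ (NormedSpace.exp (s • x)))
  simpa [ContinuousAt, Function.comp_def, ← map_exp_smul_add hmul] using h

theorem hasDerivAt_map_exp_smul {φ : A → ℂ} (hmul : ∀ x y, φ (x * y) = φ x * φ y)
    (hspec : ∀ x, φ x ∈ spectrum ℂ x) (x : A) :
    HasDerivAt (fun t : ℝ => φ (NormedSpace.exp (t • x))) (expDeriv φ x) 0 := by
  have h1 := map_one_of_mem_spectrum hspec
  have h := additive_char_hasDerivAt (continuous_map_exp_smul hmul hspec x) (by simp [h1])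
    (map_exp_smul_add hmul x) 0
  exact h.differentiableAt.hasDerivAt

theorem map_exp_eq_exp_expDeriv {φ : A → ℂ} (hmul : ∀ x y, φ (x * y) = φ x * φ y)
    (hspec : ∀ x, φ x ∈ spectrum ℂ x) (x : A) :
    φ (NormedSpace.exp x) = Complex.exp (expDeriv φ x) := by
  simpa [expDeriv] using additive_char_eq_exp (continuous_map_exp_smul hmul hspec x)
    (by simp [map_one_of_mem_spectrum hspec]) (map_exp_smul_add hmul x)

theorem expDeriv_real_smul {φ : A → ℂ} (hmul : ∀ x y, φ (x * y) = φ x * φ y)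
    (hspec : ∀ x, φ x ∈ spectrum ℂ x) (r : ℝ) (x : A) :
    expDeriv φ (r • x) = r • expDeriv φ x := by
  have h0 : HasDerivAt (fun t : ℝ => φ (NormedSpace.exp (t • x))) (expDeriv φ x) (0 * r) := by
    simpa using hasDerivAt_map_exp_smul hmul hspec x
  have h := h0.scomp (0 : ℝ) ((hasDerivAt_id (0 : ℝ)).mul_const r)
  refine (hasDerivAt_map_exp_smul hmul hspec (r • x)).unique ?_
  simpa [Function.comp_def, smul_smul] using h

theorem expDeriv_mem_spectrum {φ : A → ℂ} (hmul : ∀ x y, φ (x * y) = φ x * φ y)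
    (hspec : ∀ x, φ x ∈ spectrum ℂ x) (x : A) : expDeriv φ x ∈ spectrum ℂ x := by
  have h1 := map_one_of_mem_spectrum hspec
  have hφ := hasDerivAt_iff_tendsto_slope_zero.mp (hasDerivAt_map_exp_smul hmul hspec x)
  have he := hasDerivAt_iff_tendsto_slope_zero.mp (hasDerivAt_exp_smul_const x (0 : ℝ))
  simp only [zero_add, zero_smul, NormedSpace.exp_zero, h1, one_mul] at hφ he
  have hlim := (((continuous_algebraMap ℂ A).tendsto _).comp hφ).sub he
  rw [spectrum.mem_iff]
  refine nonunits.isClosed.mem_of_tendsto hlim ?_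
  filter_upwards [self_mem_nhdsWithin] with t ht
  have ht : t ≠ 0 := ht
  have hs := hspec (NormedSpace.exp (t • x))
  rw [spectrum.mem_iff] at hs
  intro hu
  refine hs ?_
  have := hu.smul (Units.mk0 t ht)
  rw [Units.smul_def, Units.val_mk0] at this
  have halg : ∀ z : ℂ, t • algebraMap ℂ A (t⁻¹ • z) = algebraMap ℂ A z := fun z => by
    rw [Algebra.algebraMap_eq_smul_one, ← smul_assoc, smul_inv_smul₀ ht,
      ← Algebra.algebraMap_eq_smul_one]
  simpa only [Function.comp_apply, smul_sub t, halg, smul_inv_smul₀ ht, map_sub, map_one,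
    sub_sub_sub_cancel_right] using this

theorem expDeriv_add {φ : A → ℂ} (hmul : ∀ x y, φ (x * y) = φ x * φ y)
    (hspec : ∀ x, φ x ∈ spectrum ℂ x) (x y : A) :
    expDeriv φ (x + y) = expDeriv φ x + expDeriv φ y := by
  have h1 := map_one_of_mem_spectrum hspec
  have hneg : ∀ z, expDeriv φ (-z) = -expDeriv φ z := fun z => by
    simpa using expDeriv_real_smul hmul hspec (-1) z
  let w : ℝ → A := fun t => NormedSpace.exp (t • (-y)) * NormedSpace.exp (t • (-x)) *
    NormedSpace.exp (t • (x + y))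
  have hw0 : w 0 = 1 := by simp [w]
  have hw : HasDerivAt w 0 0 := by
    have h := ((hasDerivAt_exp_smul_const (-y) (0 : ℝ)).mul
      (hasDerivAt_exp_smul_const (-x) (0 : ℝ))).mul (hasDerivAt_exp_smul_const (x + y) (0 : ℝ))
    refine h.congr_deriv ?_
    simp
  have hφw : HasDerivAt (fun t => φ (w t)) 0 0 := by
    rw [hasDerivAt_iff_isLittleO] at hw ⊢
    refine (Asymptotics.IsBigO.of_bound ‖(1 : A)‖ (Eventually.of_forall fun t => ?_)).trans_isLittleO
      hw
    simpa [hw0, h1, mul_comm] using norm_sub_one_le_of_mem_spectrum hspec (w t)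
  have hprod := ((hasDerivAt_map_exp_smul hmul hspec (-y)).mul
    (hasDerivAt_map_exp_smul hmul hspec (-x))).mul (hasDerivAt_map_exp_smul hmul hspec (x + y))
  have hfun : (fun t => φ (w t)) = (fun t : ℝ => φ (NormedSpace.exp (t • (-y)))) *
      (fun t : ℝ => φ (NormedSpace.exp (t • (-x)))) *
        fun t : ℝ => φ (NormedSpace.exp (t • (x + y))) := by
    funext t; simp [w, hmul]
  rw [hfun] at hφw
  have h := hφw.unique hprod
  simp [h1, hneg] at h
  linear_combination -h

theorem expDeriv_units_conj {φ : A → ℂ} (hmul : ∀ x y, φ (x * y) = φ x * φ y)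
    (hspec : ∀ x, φ x ∈ spectrum ℂ x) (u : Aˣ) (x : A) :
    expDeriv φ (u * x * ↑u⁻¹) = expDeriv φ x := by
  let := NormedAlgebra.restrictScalars ℚ ℂ A
  have hu : φ u * φ ↑u⁻¹ = 1 := by
    rw [← hmul, Units.mul_inv, map_one_of_mem_spectrum hspec]
  unfold expDeriv
  congr 1
  funext t
  rw [← smul_mul_assoc, ← mul_smul_comm, NormedSpace.exp_units_conj, hmul, hmul]
  linear_combination φ (NormedSpace.exp (t • x)) * hu

theorem exists_continuousLinearMap_eq_expDeriv {φ : A → ℂ}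
    (hmul : ∀ x y, φ (x * y) = φ x * φ y) (hspec : ∀ x, φ x ∈ spectrum ℂ x) :
    ∃ F : A →L[ℂ] ℂ, ∀ x, F x = expDeriv φ x := by
  let f : A →L[ℝ] ℂ := LinearMap.mkContinuous
    { toFun := expDeriv φ
      map_add' := expDeriv_add hmul hspec
      map_smul' := expDeriv_real_smul hmul hspec } ‖(1 : A)‖ fun x => by
        rw [mul_comm]
        exact spectrum.norm_le_norm_mul_of_mem (expDeriv_mem_spectrum hmul hspec x)
  exact f.exists_complex_of_map_I_smul
    (f.map_I_smul_of_mem_spectrum (expDeriv_mem_spectrum hmul hspec))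

theorem map_mul_comm_of_units_conj (F : A →L[ℂ] ℂ)
    (hF : ∀ (u : Aˣ) (x : A), F (u * x * ↑u⁻¹) = F x) (x y : A) : F (x * y) = F (y * x) := by
  obtain ⟨c, hc⟩ : ∃ c : ℂ, c ∉ spectrum ℂ y := by
    refine ⟨((‖y‖ * ‖(1 : A)‖ + 1 : ℝ) : ℂ), fun h => ?_⟩
    have := spectrum.norm_le_norm_mul_of_mem h
    rw [Complex.norm_real, Real.norm_of_nonneg (by positivity)] at this
    linarith
  obtain ⟨u, hu⟩ := spectrum.notMem_iff.mp hc
  have h := hF u (x * u)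
  rw [mul_assoc, mul_assoc, Units.mul_inv, mul_one, hu, sub_mul, mul_sub, map_sub, map_sub,
    Algebra.commutes c x] at h
  linear_combination h

theorem map_mul_of_eq_expDeriv {φ : A → ℂ} (hmul : ∀ x y, φ (x * y) = φ x * φ y)
    (hspec : ∀ x, φ x ∈ spectrum ℂ x) (F : A →L[ℂ] ℂ) (hF : ∀ x, F x = expDeriv φ x) (x y : A) :
    F (x * y) = F x * F y := by
  have hFspec : ∀ x, F x ∈ spectrum ℂ x := fun x => hF x ▸ expDeriv_mem_spectrum hmul hspec x
  have hsq := F.map_mul_self_of_exp_ne_zero (map_one_of_mem_spectrum hFspec)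
    fun z => ne_zero_of_isUnit_of_mem_spectrum hFspec (isUnit_exp_banach z)
  have hcomm := map_mul_comm_of_units_conj F
    (fun u z => by rw [hF, hF, expDeriv_units_conj hmul hspec]) x y
  have h := hsq (x + y)
  rw [add_mul, mul_add, mul_add, map_add, map_add, map_add, map_add, hsq, hsq, ← hcomm] at h
  linear_combination h / 2

theorem map_exp_nhds_zero : map (NormedSpace.exp : A → A) (𝓝 0) = 𝓝 1 := by
  have h : HasStrictFDerivAt (NormedSpace.exp : A → A)
      ((ContinuousLinearEquiv.refl ℂ A : A ≃L[ℂ] A) : A →L[ℂ] A) 0 :=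
    hasStrictFDerivAt_exp_zero
  simpa using h.map_nhds_eq_of_equiv

theorem eventually_map_eq_of_eq_expDeriv {φ : A → ℂ} (hmul : ∀ x y, φ (x * y) = φ x * φ y)
    (hspec : ∀ x, φ x ∈ spectrum ℂ x) (F : A →L[ℂ] ℂ) (hF : ∀ x, F x = expDeriv φ x) :
    ∀ᶠ u in 𝓝 (1 : A), F u = φ u := by
  rw [← map_exp_nhds_zero, eventually_map]
  refine Eventually.of_forall fun x => ?_
  have hFspec : ∀ x, F x ∈ spectrum ℂ x := fun x => hF x ▸ expDeriv_mem_spectrum hmul hspec x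
  have hFexp := map_exp_eq_exp_expDeriv (map_mul_of_eq_expDeriv hmul hspec F hF) hFspec x
  have hder : expDeriv F x = F x := by
    have h := (F.restrictScalars ℝ).hasFDerivAt.comp_hasDerivAt (0 : ℝ) (hasDerivAt_exp_smul_const x (0 : ℝ))
    simpa [expDeriv, Function.comp_def] using h.deriv
  rw [hFexp, hder, hF, map_exp_eq_exp_expDeriv hmul hspec]

omit [NormedAlgebra ℂ A] in
theorem eqOn_connectedComponentIn_isUnit {φ F : A → ℂ} (hφ : ∀ x y, φ (x * y) = φ x * φ y)
    (hF : ∀ x y, F (x * y) = F x * F y) (hne : ∀ u, IsUnit u → φ u ≠ 0)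
    (h : ∀ᶠ u in 𝓝 (1 : A), F u = φ u) :
    Set.EqOn F φ (connectedComponentIn {x : A | IsUnit x} 1) := by
  have hloc : ∀ u : A, IsUnit u → ∀ᶠ v in 𝓝 u, IsUnit v ∧ (F v = φ v ↔ F u = φ u) := by
    rintro _ ⟨u, rfl⟩
    have hlim : Tendsto (fun v : A => ↑u⁻¹ * v) (𝓝 u) (𝓝 1) := by
      have hc : Continuous fun v : A => ↑u⁻¹ * v := by fun_prop
      simpa using hc.tendsto u
    filter_upwards [hlim.eventually h, Units.nhds u] with v hv hvu
    have hw : IsUnit (↑u⁻¹ * v) := u⁻¹.isUnit.mul hvu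
    have hv' : v = u * (↑u⁻¹ * v) := by simp
    refine ⟨hvu, ?_⟩
    rw [hv', hφ, hF, hv]
    exact mul_left_inj' (hne _ hw)
  have h1 : F 1 = φ 1 := h.self_of_nhds
  have hS : IsOpen {u : A | IsUnit u ∧ F u = φ u} := isOpen_iff_mem_nhds.mpr fun u hu => by
    filter_upwards [hloc u hu.1] with v hv using ⟨hv.1, hv.2.mpr hu.2⟩
  have hT : IsOpen {u : A | IsUnit u ∧ F u ≠ φ u} := isOpen_iff_mem_nhds.mpr fun u hu => by
    filter_upwards [hloc u hu.1] with v hv using ⟨hv.1, fun e => hu.2 (hv.2.mp e)⟩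
  have hsub := isPreconnected_connectedComponentIn.subset_left_of_subset_union hS hT
    (Set.disjoint_left.mpr fun u hu hu' => hu'.2 hu.2)
    (s := connectedComponentIn {x : A | IsUnit x} 1) (fun u hu => by
      have := connectedComponentIn_subset _ _ hu
      by_cases e : F u = φ u
      exacts [Or.inl ⟨this, e⟩, Or.inr ⟨this, e⟩])
    ⟨1, mem_connectedComponentIn isUnit_one, isUnit_one, h1⟩
  exact fun u hu => (hsub hu).2

theorem connectedComponentIn_isUnit_one_mem_nhds :
    connectedComponentIn {x : A | IsUnit x} 1 ∈ 𝓝 (1 : A) := by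
  obtain ⟨ε, hε, hsub⟩ := Metric.isOpen_iff.mp (Units.isOpen (R := A)) 1 isUnit_one
  exact mem_of_superset (Metric.ball_mem_nhds 1 hε)
    ((convex_ball (1 : A) ε).isPreconnected.subset_connectedComponentIn
      (Metric.mem_ball_self hε) hsub)

omit [CompleteSpace A] in
theorem IsLinearMap.eq_of_eventuallyEq {ψ χ : A → ℂ} {a : A} (hψ : IsLinearMap ℂ ψ)
    (hχ : IsLinearMap ℂ χ) (h : ∀ᶠ u in 𝓝 a, ψ u = χ u) : ψ = χ := by
  funext x
  have hlim : Tendsto (fun t : ℂ => a + t • x) (𝓝[≠] 0) (𝓝 a) := by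
    have hc : Continuous fun t : ℂ => a + t • x := by fun_prop
    simpa using (hc.tendsto 0).mono_left nhdsWithin_le_nhds
  obtain ⟨t, ht, ht0⟩ := ((hlim.eventually h).and self_mem_nhdsWithin).exists
  have ht0 : t ≠ 0 := ht0
  rw [hψ.map_add, hχ.map_add, hψ.map_smul, hχ.map_smul, h.self_of_nhds] at ht
  exact mul_left_cancel₀ ht0 (add_left_cancel ht)

end BanachAlgebra

/-- Maouche's theorem. -/
theorem stmt_17 {A : Type*} [NormedRing A] [NormedAlgebra ℂ A] [CompleteSpace A]
    (φ : A → ℂ) (hmul : ∀ x y : A, φ (x * y) = φ x * φ y)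
    (hspec : ∀ x : A, φ x ∈ spectrum ℂ x) :
    ∃! ψ : A → ℂ, IsCharacter ψ ∧
      ∀ u ∈ connectedComponentIn {x : A | IsUnit x} 1, ψ u = φ u := by
  obtain ⟨F, hF⟩ := exists_continuousLinearMap_eq_expDeriv hmul hspec
  have hFmul := map_mul_of_eq_expDeriv hmul hspec F hF
  have hFlin : IsLinearMap ℂ F := ⟨map_add F, map_smul F⟩
  have hFφ : ∀ u ∈ connectedComponentIn {x : A | IsUnit x} 1, F u = φ u :=
    eqOn_connectedComponentIn_isUnit hmul hFmul
      (fun _ hu => ne_zero_of_isUnit_of_mem_spectrum hspec hu)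
      (eventually_map_eq_of_eq_expDeriv hmul hspec F hF)
  have hFne : (F : A → ℂ) ≠ 0 := fun h => by
    have h1 : F 1 = φ 1 := hFφ 1 (mem_connectedComponentIn isUnit_one)
    rw [h, map_one_of_mem_spectrum hspec] at h1
    exact zero_ne_one h1
  refine ⟨F, ⟨⟨hFne, hFlin, hFmul⟩, hFφ⟩, fun ψ hψ => ?_⟩
  refine hψ.1.2.1.eq_of_eventuallyEq hFlin ?_ (a := 1)
  filter_upwards [connectedComponentIn_isUnit_one_mem_nhds] with u hu
  rw [hψ.2 u hu, hFφ u hu]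
end

section
/- Let A be a unital C*-algebra and let φ : A → ℂ be a continuous spectrally multiplicative function. Then either φ is a character of A or −φ is a character of A. -/
open scoped ComplexConjugate

open Filter Topology

/-- A function on `ℂ` that is an exponential relative to every base point, with real bounded
slope, is globally an exponential with real slope. -/
lemma exists_eq_exp_of_ratio {F : ℂ → ℂ} {M : ℝ} (hM : 0 ≤ M) (h0 : F 0 = 1)
    (hF : ∀ z w, ∃ t : ℝ, |t| ≤ M ∧ F z = F w * Complex.exp ((z - w) * t)) :
    ∃ a : ℝ, ∀ z, F z = Complex.exp (z * a) := by
  have hpos : 0 < M + 1 := by linarith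
  set r : ℝ := 1 / (M + 1) with hr
  have hr0 : 0 < r := by positivity
  have hrM : r * M ≤ 1 := by
    rw [hr, one_div, inv_mul_le_iff₀ hpos]; linarith
  have hs : ∀ z, ∃ t : ℝ, |t| ≤ M ∧ F z = Complex.exp (z * t) := fun z ↦ by
    simpa [h0] using hF z 0
  choose s hsM hsF using hs
  have norm_le : ∀ (z : ℂ) (t : ℝ) (c : ℝ), ‖z‖ ≤ c → |t| ≤ M → ‖z * t‖ ≤ c * M := by
    intro z t c hz ht
    rw [norm_mul, Complex.norm_real, Real.norm_eq_abs]
    exact mul_le_mul hz ht (abs_nonneg _) ((norm_nonneg _).trans hz)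
  have key : ∀ z w : ℂ, ‖z‖ ≤ r → ‖w‖ ≤ r → ∃ t : ℝ, z * (s z - t) = w * (s w - t) := by
    intro z w hz hw
    obtain ⟨t, htM, ht⟩ := hF z w
    rw [hsF z, hsF w, ← Complex.exp_add, Complex.exp_eq_exp_iff_exists_int] at ht
    obtain ⟨n, hn⟩ := ht
    have hn' : (n : ℂ) * (2 * Real.pi * Complex.I) = z * s z - w * s w - (z - w) * t := by
      rw [hn]; ring
    have h1 : ‖(n : ℂ) * (2 * Real.pi * Complex.I)‖ ≤ 4 := by
      rw [hn']
      have e1 := norm_le z (s z) r hz (hsM z)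
      have e2 := norm_le w (s w) r hw (hsM w)
      have e3 := norm_le (z - w) t (r + r) ((norm_sub_le _ _).trans (add_le_add hz hw)) htM
      have e4 := norm_sub_le (z * s z - w * s w) ((z - w) * t)
      have e5 := norm_sub_le (z * (s z : ℂ)) (w * s w)
      linarith
    have hn0 : n = 0 := by
      by_contra hne
      have : (1 : ℝ) ≤ |(n : ℝ)| := by exact_mod_cast Int.one_le_abs hne
      have h2 : ‖(n : ℂ) * (2 * Real.pi * Complex.I)‖ = |(n : ℝ)| * (2 * Real.pi) := by
        simp [abs_of_pos Real.pi_pos]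
      rw [h2] at h1
      nlinarith [Real.pi_gt_three]
    refine ⟨t, ?_⟩
    rw [hn0] at hn'
    simp only [Int.cast_zero, zero_mul] at hn'
    linear_combination -hn'
  have hnr : ‖(r : ℂ)‖ ≤ r := by simp [abs_of_pos hr0]
  have hnrI : ‖(r : ℂ) * Complex.I‖ ≤ r := by simp [abs_of_pos hr0]
  set a := s r with ha
  have nonreal : ∀ w : ℂ, ‖w‖ ≤ r → w.im ≠ 0 → s w = a := by
    intro w hw him
    obtain ⟨t, ht⟩ := key r w hnr hw
    have h1 := congrArg Complex.im ht
    have h2 := congrArg Complex.re ht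
    simp [him] at h1
    have h3 : s w = t := by linarith
    rw [h3] at h2
    simp [hr0.ne'] at h2
    linarith
  have small : ∀ w : ℂ, ‖w‖ ≤ r → F w = Complex.exp (w * a) := by
    intro w hw
    by_cases him : w.im = 0
    · by_cases hre : w.re = 0
      · have : w = 0 := Complex.ext hre him
        simp [this, h0]
      · obtain ⟨t, ht⟩ := key (r * Complex.I) w hnrI hw
        have h1 := congrArg Complex.im ht
        have h2 := congrArg Complex.re ht
        simp [him, hr0.ne'] at h1
        simp [hre] at h2
        have h3 := nonreal _ hnrI (by simp [hr0.ne'])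
        rw [hsF w]
        have : s w = a := by linarith
        rw [this]
    · rw [hsF w, nonreal w hw him]
  refine ⟨a, fun z ↦ ?_⟩
  rcases eq_or_ne z 0 with rfl | hz
  · simp [h0]
  have hδ : 0 < r / ‖z‖ := by positivity
  have hw : ∀ ε : Set.Ioo 0 (r / ‖z‖), ‖-(ε.1 * Complex.I * z)‖ ≤ r := by
    rintro ⟨ε, h1, h2⟩
    rw [lt_div_iff₀ (norm_pos_iff.2 hz)] at h2
    simpa [abs_of_pos h1] using h2.le
  have hn : ∀ ε : Set.Ioo 0 (r / ‖z‖), ∃ n : ℤ, ∃ t : ℝ,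
      F z = Complex.exp (-(ε.1 * Complex.I * z) * a + (z + ε.1 * Complex.I * z) * t) ∧
      z * s z = -(ε.1 * Complex.I * z) * a + (z + ε.1 * Complex.I * z) * t
        + n * (2 * Real.pi * Complex.I) := by
    intro ε
    obtain ⟨t, -, ht⟩ := hF z (-(ε.1 * Complex.I * z))
    rw [small _ (hw ε), ← Complex.exp_add, sub_neg_eq_add] at ht
    have ht' := ht
    rw [hsF z, Complex.exp_eq_exp_iff_exists_int] at ht'
    obtain ⟨n, hn⟩ := ht'
    exact ⟨n, t, ht, hn⟩
  choose n t hFt hzt using hn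
  have hninj : ¬ Function.Injective n := by
    intro hinj
    have := hinj.countable
    rw [Set.countable_coe_iff] at this
    exact (Cardinal.Real.Ioo_countable_iff.1 this).not_gt hδ
  simp only [Function.Injective, not_forall] at hninj
  obtain ⟨ε, ε', hnn, hne⟩ := hninj
  have heq := (hzt ε).symm.trans (hzt ε')
  rw [hnn] at heq
  have h1 : z * (-(ε.1 * Complex.I) * a + (1 + ε.1 * Complex.I) * t ε) =
      z * (-(ε'.1 * Complex.I) * a + (1 + ε'.1 * Complex.I) * t ε') := by
    linear_combination heq
  have h2 := mul_left_cancel₀ hz h1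
  have hre := congrArg Complex.re h2
  have him := congrArg Complex.im h2
  simp at hre him
  rw [← hre] at him
  have hta : t ε = a := by
    have : (ε.1 - ε'.1) * (t ε - a) = 0 := by linear_combination him
    rcases mul_eq_zero.1 this with h | h
    · exact absurd (Subtype.ext (sub_eq_zero.1 h)) hne
    · linarith
  rw [hFt ε, hta]
  congr 1
  ring

/-- If `v` is a limit of points of every logarithmic spiral from `c` to `0`, then it is an
endpoint. -/
lemma eq_zero_or_eq_of_forall_spiral {v c : ℂ}
    (h : ∀ θ : ℝ, ∀ d > 0, ∃ u : ℝ, ‖v - c * Complex.exp (-(1 + θ * Complex.I) * u)‖ < d) :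
    v = 0 ∨ v = c := by
  by_contra! hv
  obtain ⟨hv0, hvc⟩ := hv
  have hc0 : c ≠ 0 := by
    rintro rfl
    obtain ⟨u, hu⟩ := h 0 ‖v‖ (norm_pos_iff.2 hv0)
    simp at hu
  set u₀ : ℝ := Real.log ‖c‖ - Real.log ‖v‖ with hu₀
  have main : ∀ θ : ℝ, v = c * Complex.exp (-(1 + θ * Complex.I) * u₀) := by
    intro θ
    have hseq : ∀ n : ℕ, ∃ u : ℝ, ‖v - c * Complex.exp (-(1 + θ * Complex.I) * u)‖ <
      1 / ((n : ℝ) + 1) := fun n ↦ h θ _ (by positivity)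
    choose u hu using hseq
    have hlim : Tendsto (fun n ↦ c * Complex.exp (-(1 + θ * Complex.I) * u n)) atTop (𝓝 v) := by
      rw [tendsto_iff_norm_sub_tendsto_zero]
      refine squeeze_zero (fun _ ↦ norm_nonneg _) (fun n ↦ ?_)
        (tendsto_one_div_add_atTop_nhds_zero_nat (𝕜 := ℝ))
      rw [norm_sub_rev]
      exact (hu n).le
    have hlog := (hlim.norm).log (norm_ne_zero_iff.2 hv0)
    have hlog' : ∀ n, Real.log ‖c * Complex.exp (-(1 + θ * Complex.I) * u n)‖ =
        Real.log ‖c‖ - u n := fun n ↦ by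
      rw [norm_mul, Complex.norm_exp, Real.log_mul (norm_ne_zero_iff.2 hc0) (Real.exp_ne_zero _),
        Real.log_exp]
      simp [sub_eq_add_neg]
    simp only [hlog'] at hlog
    have hulim : Tendsto u atTop (𝓝 u₀) := by
      simpa using hlog.const_sub (Real.log ‖c‖)
    have hcont : Continuous fun u : ℝ ↦ c * Complex.exp (-(1 + θ * Complex.I) * u) := by fun_prop
    exact tendsto_nhds_unique hlim ((hcont.tendsto u₀).comp hulim)
  by_cases hz : u₀ = 0
  · apply hvc
    simpa [hz] using main 0
  · have e0 := main 0
    have e1 := main (Real.pi / u₀)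
    have hz' : (u₀ : ℂ) ≠ 0 := by exact_mod_cast hz
    have e2 : -(1 + ((Real.pi / u₀ : ℝ) : ℂ) * Complex.I) * u₀ =
        -(1 + ((0 : ℝ) : ℂ) * Complex.I) * u₀ - Real.pi * Complex.I := by
      push_cast
      field_simp
      ring
    rw [e2, Complex.exp_sub, Complex.exp_pi_mul_I] at e1
    apply hv0
    linear_combination (e0 + e1) / 2

/-- A linear functional preserving squares is multiplicative. -/
lemma map_mul_of_map_mul_self {R : Type*} [Ring R] [Algebra ℂ R] (ψ : R →ₗ[ℂ] ℂ) (h1 : ψ 1 = 1)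
    (hsq : ∀ x, ψ (x * x) = ψ x ^ 2) (x y : R) : ψ (x * y) = ψ x * ψ y := by
  have jordan : ∀ x y, ψ (x * y) + ψ (y * x) = 2 * ψ x * ψ y := by
    intro x y
    have h := hsq (x + y)
    simp only [add_mul, mul_add, map_add, hsq] at h
    linear_combination h
  have ker : ∀ x y, ψ x = 0 → ψ (x * y) = 0 := by
    intro x y hx
    have h := jordan x y
    have h2 := jordan x (y * x * y)
    have h3 := hsq (x * y - y * x)
    have h4 := hsq (x * y + y * x)
    simp only [sub_mul, mul_sub, add_mul, mul_add, map_add, map_sub, mul_assoc] at h2 h3 h4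
    rw [hx] at h h2
    have e1 : ψ (x * y) + ψ (y * x) = 0 := by linear_combination h
    rw [e1] at h4
    have e2 : (ψ (x * y) - ψ (y * x)) ^ 2 = 0 := by linear_combination -h3 + 2 * h2 - h4
    have e3 := pow_eq_zero_iff (two_ne_zero) |>.1 e2
    linear_combination (e1 + e3) / 2
  have h := ker (x - ψ x • 1) y (by simp [h1])
  simp only [sub_mul, smul_mul_assoc, one_mul, map_sub, map_smul, smul_eq_mul] at h
  linear_combination h

section CStar

variable {A : Type*} [CStarAlgebra A]

lemma exp_smul_eq_cfc {h : A} (hh : IsSelfAdjoint h) (z : ℂ) :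
    NormedSpace.exp (z • h) = cfc (fun s : ℂ ↦ Complex.exp (z * s)) h := by
  have hn : IsStarNormal h := hh.isStarNormal
  have hz : IsStarNormal (z • h) := inferInstance
  rw [cfc_comp_const_mul z Complex.exp h, CFC.complex_exp_eq_normedSpace_exp]

lemma exp_smul_mul_exp_smul {h : A} (hh : IsSelfAdjoint h) (z w : ℂ) :
    NormedSpace.exp (z • h) * NormedSpace.exp (w • h) = NormedSpace.exp ((z + w) • h) := by
  rw [exp_smul_eq_cfc hh, exp_smul_eq_cfc hh, exp_smul_eq_cfc hh, ← cfc_mul _ _ _]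
  simp_rw [← Complex.exp_add, add_mul]

lemma exists_real_of_mem_spectrum_cfc {h : A} (hh : IsSelfAdjoint h) {f : ℂ → ℂ}
    (hf : Continuous f) {c : ℂ} (hc : c ∈ spectrum ℂ (cfc f h)) :
    ∃ t : ℝ, |t| ≤ ‖h‖ ∧ (t : ℂ) ∈ spectrum ℂ h ∧ c = f t := by
  have hn : IsStarNormal h := hh.isStarNormal
  rw [cfc_map_spectrum f h] at hc
  obtain ⟨s, hs, rfl⟩ := hc
  have : Nontrivial A := by
    by_contra hA
    rw [not_nontrivial_iff_subsingleton] at hA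
    simp [spectrum.of_subsingleton] at hs
  have hre := hh.mem_spectrum_eq_re hs
  rw [hre] at hs
  have hnorm := spectrum.norm_le_norm_of_mem hs
  rw [Complex.norm_real, Real.norm_eq_abs] at hnorm
  exact ⟨s.re, hnorm, hs, by rw [← hre]⟩

lemma exists_real_of_mem_spectrum_exp {h : A} (hh : IsSelfAdjoint h) {z c : ℂ}
    (hc : c ∈ spectrum ℂ (NormedSpace.exp (z • h))) :
    ∃ t : ℝ, |t| ≤ ‖h‖ ∧ c = Complex.exp (z * t) := by
  rw [exp_smul_eq_cfc hh] at hc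
  obtain ⟨t, h1, -, h2⟩ := exists_real_of_mem_spectrum_cfc hh (by fun_prop) hc
  exact ⟨t, h1, h2⟩

lemma exists_real_of_mem_spectrum_smul {h : A} (hh : IsSelfAdjoint h) {z c : ℂ}
    (hc : c ∈ spectrum ℂ (z • h)) : ∃ t : ℝ, c = z * t := by
  have hn : IsStarNormal h := hh.isStarNormal
  rw [← cfc_const_mul_id z h] at hc
  obtain ⟨t, -, -, h2⟩ := exists_real_of_mem_spectrum_cfc hh (by fun_prop) hc
  exact ⟨t, h2⟩

lemma exists_real_nonneg_of_mem_spectrum_star_mul_self {n : A} {s : ℂ}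
    (hs : s ∈ spectrum ℂ (star n * n)) : ∃ t : ℝ, 0 ≤ t ∧ s = t := by
  have hre := (IsSelfAdjoint.star_mul_self n).mem_spectrum_eq_re hs
  refine ⟨s.re, spectrum_star_mul_self_nonneg (b := n) _ ?_, hre⟩
  rw [hre] at hs
  exact (spectrum.algebraMap_mem_iff ℂ).1 hs

lemma norm_mul_exp_smul_star_mul_self_le (n : A) {z : ℂ} {d : ℝ} (hd : 0 < d)
    (hz : z.re = -(2 / d ^ 2)) :
    ‖n * NormedSpace.exp (z • (star n * n))‖ ≤ d / 2 := by
  have hp := IsSelfAdjoint.star_mul_self n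
  have hpn : IsStarNormal (star n * n) := hp.isStarNormal
  refine abs_le_of_sq_le_sq' ?_ (by positivity) |>.2
  have e : star (n * NormedSpace.exp (z • (star n * n))) *
      (n * NormedSpace.exp (z • (star n * n))) =
      cfc (fun s : ℂ ↦ star (Complex.exp (z * s)) * (s * Complex.exp (z * s))) (star n * n) := by
    rw [exp_smul_eq_cfc hp, cfc_mul _ _ _, cfc_star, cfc_mul _ _ _, cfc_id' ℂ (star n * n),
      star_mul]
    simp only [mul_assoc]
  rw [sq, ← CStarRing.norm_star_mul_self, e]
  refine norm_cfc_le (by positivity) fun s hs ↦ ?_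
  obtain ⟨t, ht, rfl⟩ := exists_real_nonneg_of_mem_spectrum_star_mul_self hs
  have e1 : ‖star (Complex.exp (z * t)) * (t * Complex.exp (z * t))‖ =
      t * Real.exp (-(4 / d ^ 2 * t)) := by
    rw [norm_mul, norm_star, norm_mul, Complex.norm_real, Real.norm_of_nonneg ht,
      Complex.norm_exp, mul_left_comm, ← Real.exp_add]
    congr 2
    simp [hz]
    ring
  rw [e1, Real.exp_neg, ← div_eq_mul_inv, div_le_iff₀ (Real.exp_pos _)]
  have h2 := Real.add_one_le_exp (4 / d ^ 2 * t)
  calc t = d ^ 2 / 4 * (4 / d ^ 2 * t) := by field_simp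
    _ ≤ d ^ 2 / 4 * Real.exp (4 / d ^ 2 * t) := by gcongr; linarith
    _ = _ := by ring

/-- If `v` has distance at least `d` from the logarithmic spiral from `c` to `0`, then a suitable
exponential damping factor removes `v` from the spectrum of `c + n`. -/
lemma notMem_spectrum_add_mul_exp (n : A) {c v : ℂ} {d θ : ℝ} (hd : 0 < d)
    (hdist : ∀ u : ℝ, d ≤ ‖v - c * Complex.exp (-(1 + θ * Complex.I) * u)‖) :
    v ∉ spectrum ℂ ((c • 1 + n) * NormedSpace.exp
      ((-(1 + θ * Complex.I) * (2 / d ^ 2 : ℝ)) • (star n * n))) := by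
  set z : ℂ := -(1 + θ * Complex.I) * (2 / d ^ 2 : ℝ) with hz
  have hzre : z.re = -(2 / d ^ 2) := by
    rw [hz, Complex.re_mul_ofReal]; simp
  have hp := IsSelfAdjoint.star_mul_self n
  have hpn : IsStarNormal (star n * n) := hp.isStarNormal
  have hny := norm_mul_exp_smul_star_mul_self_le n hd hzre
  set y := NormedSpace.exp (z • (star n * n)) with hy
  have hdist' : ∀ s ∈ spectrum ℂ (star n * n), d ≤ ‖v - c * Complex.exp (z * s)‖ := by
    intro s hs
    obtain ⟨t, -, rfl⟩ := exists_real_nonneg_of_mem_spectrum_star_mul_self hs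
    convert hdist (2 / d ^ 2 * t) using 5
    rw [hz]; push_cast; ring
  have hne : ∀ s ∈ spectrum ℂ (star n * n), v - c * Complex.exp (z * s) ≠ 0 := fun s hs ↦
    norm_pos_iff.1 (hd.trans_le (hdist' s hs))
  have hcont' : ContinuousOn (fun s : ℂ ↦ v - c * Complex.exp (z * s))
      (spectrum ℂ (star n * n)) := by fun_prop
  have hcont : ContinuousOn (fun s : ℂ ↦ (v - c * Complex.exp (z * s))⁻¹)
      (spectrum ℂ (star n * n)) := hcont'.inv₀ hne
  set g := cfc (fun s : ℂ ↦ (v - c * Complex.exp (z * s))⁻¹) (star n * n) with hg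
  have hgn : ‖g‖ ≤ d⁻¹ := norm_cfc_le (by positivity) fun s hs ↦ by
    rw [norm_inv]
    exact inv_anti₀ hd (hdist' s hs)
  set w := cfc (fun s : ℂ ↦ v - c * Complex.exp (z * s)) (star n * n) with hw
  have hw' : w = algebraMap ℂ A v - c • y := by
    rw [hw, cfc_sub _ _ _, cfc_const _ _, cfc_const_mul _ _ _, hy, exp_smul_eq_cfc hp]
  have hwg : w * g = 1 := by
    rw [hw, hg, ← cfc_mul _ _ _ hcont' hcont, ← cfc_one ℂ (star n * n)]
    exact cfc_congr fun s hs ↦ mul_inv_cancel₀ (hne s hs)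
  have hgw : g * w = 1 := by
    rw [hw, hg, ← cfc_mul _ _ _ hcont hcont', ← cfc_one ℂ (star n * n)]
    exact cfc_congr fun s hs ↦ inv_mul_cancel₀ (hne s hs)
  rw [spectrum.notMem_iff]
  have hfac : algebraMap ℂ A v - (c • 1 + n) * y = w * (1 - g * (n * y)) := by
    rw [mul_sub, ← mul_assoc, hwg, hw', add_mul]
    simp
    abel
  rw [hfac]
  refine (IsUnit.mul ⟨⟨w, g, hwg, hgw⟩, rfl⟩ (isUnit_one_sub_of_norm_lt_one ?_))
  calc ‖g * (n * y)‖ ≤ ‖g‖ * ‖n * y‖ := norm_mul_le _ _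
    _ ≤ d⁻¹ * (d / 2) := by gcongr
    _ < 1 := by field_simp; norm_num

namespace SpectrallyMultiplicative

variable {φ : A → ℂ}

lemma nontrivial (hsm : SpectrallyMultiplicative φ) : Nontrivial A := by
  by_contra hA
  rw [not_nontrivial_iff_subsingleton] at hA
  simpa [spectrum.of_subsingleton] using hsm 0 0

lemma map_mul_map_eq_one (hsm : SpectrallyMultiplicative φ) {x y : A} (h : x * y = 1) :
    φ x * φ y = 1 := by
  have := hsm.nontrivial
  simpa [h] using hsm x y

lemma exists_exp_slope (hsm : SpectrallyMultiplicative φ) (h1 : φ 1 = 1) {h : A}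
    (hh : IsSelfAdjoint h) :
    ∃ a : ℝ, ∀ z : ℂ, φ (NormedSpace.exp (z • h)) = Complex.exp (z * a) := by
  refine exists_eq_exp_of_ratio (norm_nonneg h) (by simp [h1]) fun z w ↦ ?_
  have e := hsm (NormedSpace.exp (z • h)) (NormedSpace.exp ((-w) • h))
  rw [exp_smul_mul_exp_smul hh] at e
  obtain ⟨t, ht, h2⟩ := exists_real_of_mem_spectrum_exp hh e
  have h3 : φ (NormedSpace.exp (w • h)) * φ (NormedSpace.exp ((-w) • h)) = 1 :=
    hsm.map_mul_map_eq_one (by rw [exp_smul_mul_exp_smul hh]; simp)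
  refine ⟨t, ht, ?_⟩
  rw [sub_eq_add_neg, ← h2]
  linear_combination -φ (NormedSpace.exp (z • h)) * h3

/-- The slope of the one-parameter family `z ↦ φ (exp (z • h))`. -/
noncomputable def slope (hsm : SpectrallyMultiplicative φ) (h1 : φ 1 = 1)
    (h : selfAdjoint A) : ℝ :=
  (hsm.exists_exp_slope h1 h.2).choose

variable (hsm : SpectrallyMultiplicative φ) (h1 : φ 1 = 1)

lemma map_exp_smul (h : selfAdjoint A) (z : ℂ) :
    φ (NormedSpace.exp (z • (h : A))) = Complex.exp (z * hsm.slope h1 h) :=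
  (hsm.exists_exp_slope h1 h.2).choose_spec z

lemma slope_real_smul (s : ℝ) (h : selfAdjoint A) :
    hsm.slope h1 (s • h) = s * hsm.slope h1 h := by
  have e := hsm.map_exp_smul h1 (s • h) 1
  have e' := hsm.map_exp_smul h1 h s
  simp only [selfAdjoint.val_smul, one_smul, one_mul, Complex.coe_smul] at e e'
  rw [e', ← Complex.ofReal_mul, ← Complex.ofReal_exp, ← Complex.ofReal_exp] at e
  exact (Real.exp_injective (Complex.ofReal_injective e)).symm

lemma slope_zero : hsm.slope h1 0 = 0 := by
  simpa using hsm.slope_real_smul h1 0 0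

lemma map_exp_mul_exp (h k : selfAdjoint A) (s : ℝ) :
    φ (NormedSpace.exp ((s : ℂ) • (h : A)) * NormedSpace.exp ((s * Complex.I) • (k : A))) =
      Complex.exp (s * (hsm.slope h1 h + Complex.I * hsm.slope h1 k)) := by
  set x := NormedSpace.exp ((s : ℂ) • (h : A))
  set y := NormedSpace.exp ((s * Complex.I) • (k : A))
  have e1 := hsm (x * y) (NormedSpace.exp ((-(s * Complex.I)) • (k : A)))
  rw [mul_assoc, exp_smul_mul_exp_smul k.2, add_neg_cancel, zero_smul, NormedSpace.exp_zero,
    mul_one, hsm.map_exp_smul h1] at e1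
  have e2 := hsm (NormedSpace.exp ((-(s : ℂ)) • (h : A))) (x * y)
  rw [← mul_assoc, exp_smul_mul_exp_smul h.2, neg_add_cancel, zero_smul, NormedSpace.exp_zero,
    one_mul, hsm.map_exp_smul h1] at e2
  obtain ⟨t, -, ht⟩ := exists_real_of_mem_spectrum_exp h.2 e1
  obtain ⟨u, -, hu⟩ := exists_real_of_mem_spectrum_exp k.2 e2
  have e3 : φ (x * y) = Complex.exp (s * t + s * Complex.I * hsm.slope h1 k) := by
    rw [Complex.exp_add, ← ht, mul_assoc, ← Complex.exp_add]
    simp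
  have e4 : φ (x * y) = Complex.exp (s * hsm.slope h1 h + s * Complex.I * u) := by
    rw [Complex.exp_add, ← hu, ← mul_assoc, ← Complex.exp_add]
    simp
  have e5 := congrArg norm (e3.symm.trans e4)
  simp only [Complex.norm_exp] at e5
  have e6 := Real.exp_injective e5
  simp at e6
  rw [e3]
  congr 1
  rcases e6 with rfl | rfl
  · ring
  · simp

lemma slope_mem_spectrum (h k l : selfAdjoint A) :
    (hsm.slope h1 h + Complex.I * hsm.slope h1 k - hsm.slope h1 l : ℂ) ∈
      spectrum ℂ ((h : A) + Complex.I • (k : A) - l) := by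
  set c : ℂ := hsm.slope h1 h + Complex.I * hsm.slope h1 k - hsm.slope h1 l with hc
  have hd : HasDerivAt (fun s : ℝ ↦ algebraMap ℂ A (Complex.exp (s * c)) -
      NormedSpace.exp (s • (h : A)) * NormedSpace.exp (s • (Complex.I • (k : A))) *
        NormedSpace.exp (s • (-(l : A))))
      (algebraMap ℂ A c - ((h : A) + Complex.I • (k : A) - l)) 0 := by
    have d1 := hasDerivAt_exp_smul_const (𝕂 := ℝ) (h : A) 0
    have d2 := hasDerivAt_exp_smul_const (𝕂 := ℝ) (Complex.I • (k : A)) 0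
    have d3 := hasDerivAt_exp_smul_const (𝕂 := ℝ) (-(l : A)) 0
    have d0 : HasDerivAt (fun s : ℝ ↦ Complex.exp (s * c)) c 0 := by
      have := ((Complex.ofRealCLM.hasDerivAt (x := (0 : ℝ))).mul_const c).cexp
      simpa using this
    have d0' := (Algebra.linearMap ℂ A).toContinuousLinearMap.restrictScalars ℝ
      |>.hasFDerivAt.comp_hasDerivAt (0 : ℝ) d0
    refine (d0'.sub ((d1.mul d2).mul d3)).congr_deriv ?_
    simp
    abel
  have ht := hd.tendsto_slope_zero
  rw [spectrum.mem_iff]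
  refine nonunits.isClosed.mem_of_tendsto ht ?_
  filter_upwards [self_mem_nhdsWithin] with s hs
  have e := hsm (NormedSpace.exp ((s : ℂ) • (h : A)) * NormedSpace.exp ((s * Complex.I) • (k : A)))
    (NormedSpace.exp ((-s : ℂ) • (l : A)))
  rw [hsm.map_exp_mul_exp h1, hsm.map_exp_smul h1, ← Complex.exp_add, spectrum.mem_iff] at e
  intro hu
  apply e
  have hs' : IsUnit (algebraMap ℝ A s) := (IsUnit.mk0 s hs).map _
  have := hs'.mul hu
  rw [← Algebra.smul_def, smul_smul, mul_inv_cancel₀ hs, one_smul] at this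
  have e1 : (s * (hsm.slope h1 h + Complex.I * hsm.slope h1 k) + -s * hsm.slope h1 l : ℂ)
      = s * c := by rw [hc]; ring
  rw [e1]
  convert this using 1
  simp [mul_smul]

lemma slope_add (h k : selfAdjoint A) :
    hsm.slope h1 (h + k) = hsm.slope h1 h + hsm.slope h1 k := by
  have e := hsm.slope_mem_spectrum h1 h k (h + k)
  have e1 : (h : A) + Complex.I • (k : A) - (h + k : selfAdjoint A) =
      (Complex.I - 1) • (k : A) := by
    rw [sub_smul, one_smul, AddSubgroup.coe_add]; abel
  rw [e1] at e
  obtain ⟨t, ht⟩ := exists_real_of_mem_spectrum_smul k.2 e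
  have hre := congrArg Complex.re ht
  have him := congrArg Complex.im ht
  simp at hre him
  linarith

lemma slope_sq (h k : selfAdjoint A) (hk : (k : A) = h * h) :
    hsm.slope h1 k = hsm.slope h1 h ^ 2 := by
  have e := hsm.slope_mem_spectrum h1 h k 0
  have hn : IsStarNormal (h : A) := h.2.isStarNormal
  have e1 : (h : A) + Complex.I • (k : A) - (0 : selfAdjoint A) =
      cfc (fun s : ℂ ↦ s + Complex.I * (s * s)) (h : A) := by
    rw [cfc_add _ _ _, cfc_const_mul _ _ _, cfc_mul _ _ _, cfc_id' ℂ (h : A), hk]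
    simp
  rw [e1, slope_zero] at e
  obtain ⟨t, -, -, ht⟩ := exists_real_of_mem_spectrum_cfc h.2 (by fun_prop) e
  have hre := congrArg Complex.re ht
  have him := congrArg Complex.im ht
  simp at hre him
  rw [him, hre, sq]

/-- The linear functional on `A` extending `slope`. -/
noncomputable def slopeLinearMap : A →ₗ[ℂ] ℂ where
  toFun x := hsm.slope h1 (realPart x) + Complex.I * hsm.slope h1 (imaginaryPart x)
  map_add' x y := by
    simp only [map_add, slope_add]
    push_cast
    ring
  map_smul' c x := by
    simp only [realPart_smul, imaginaryPart_smul, sub_eq_add_neg, ← neg_smul, slope_add,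
      slope_real_smul, RingHom.id_apply, smul_eq_mul]
    push_cast
    conv_rhs => rw [← Complex.re_add_im c]
    linear_combination -(c.im * hsm.slope h1 (imaginaryPart x) : ℂ) * Complex.I_sq

lemma slopeLinearMap_apply (x : A) : hsm.slopeLinearMap h1 x =
    hsm.slope h1 (realPart x) + Complex.I * hsm.slope h1 (imaginaryPart x) :=
  rfl

lemma slopeLinearMap_coe (h : selfAdjoint A) :
    hsm.slopeLinearMap h1 (h : A) = hsm.slope h1 h := by
  have e1 : realPart (h : A) = h := Subtype.ext h.2.coe_realPart
  rw [slopeLinearMap_apply, e1, h.2.imaginaryPart, slope_zero]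
  simp

lemma slopeLinearMap_mem_spectrum (x : A) : hsm.slopeLinearMap h1 x ∈ spectrum ℂ x := by
  have e := hsm.slope_mem_spectrum h1 (realPart x) (imaginaryPart x) 0
  rw [slope_zero, realPart_add_I_smul_imaginaryPart] at e
  simpa [slopeLinearMap_apply] using e

lemma slopeLinearMap_one : hsm.slopeLinearMap h1 1 = 1 := by
  have := hsm.nontrivial
  simpa using hsm.slopeLinearMap_mem_spectrum h1 1

lemma slopeLinearMap_coe_mul_self (h : selfAdjoint A) :
    hsm.slopeLinearMap h1 ((h : A) * h) = hsm.slopeLinearMap h1 h ^ 2 := by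
  have hs : IsSelfAdjoint ((h : A) * h) := by
    have := h.2.pow 2
    rwa [sq] at this
  have e := hsm.slope_sq h1 h ⟨_, hs⟩ rfl
  rw [slopeLinearMap_coe, ← Complex.ofReal_pow, ← e, ← slopeLinearMap_coe]

lemma slopeLinearMap_mul (x y : A) : hsm.slopeLinearMap h1 (x * y) =
    hsm.slopeLinearMap h1 x * hsm.slopeLinearMap h1 y := by
  refine map_mul_of_map_mul_self _ (hsm.slopeLinearMap_one h1) (fun x ↦ ?_) x y
  have eh := hsm.slopeLinearMap_coe_mul_self h1 (realPart x)
  have ek := hsm.slopeLinearMap_coe_mul_self h1 (imaginaryPart x)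
  have ehk := hsm.slopeLinearMap_coe_mul_self h1 (realPart x + imaginaryPart x)
  rw [← realPart_add_I_smul_imaginaryPart x]
  generalize realPart x = h at *
  generalize imaginaryPart x = k at *
  simp only [AddSubgroup.coe_add, add_mul, mul_add, map_add, smul_mul_assoc, mul_smul_comm,
    map_smul, smul_eq_mul, eh, ek] at ehk ⊢
  linear_combination Complex.I * ehk

include h1 in
lemma map_eq_zero_or_eq (x : A) : φ x = 0 ∨ φ x = hsm.slopeLinearMap h1 x := by
  refine eq_zero_or_eq_of_forall_spiral ?_
  by_contra! hcon
  obtain ⟨θ, d, hd, hdist⟩ := hcon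
  set c := hsm.slopeLinearMap h1 x with hc
  set n := x - c • 1 with hn
  have hψn : hsm.slopeLinearMap h1 n = 0 := by
    simp [hn, slopeLinearMap_one, hc]
  have hp : hsm.slope h1 ⟨star n * n, IsSelfAdjoint.star_mul_self n⟩ = 0 := by
    have := hsm.slopeLinearMap_coe h1 ⟨star n * n, IsSelfAdjoint.star_mul_self n⟩
    rw [slopeLinearMap_mul, hψn, mul_zero] at this
    exact_mod_cast this.symm
  refine notMem_spectrum_add_mul_exp n hd hdist ?_
  rw [hn, add_sub_cancel, ← hn]
  have e := hsm.map_exp_smul h1 ⟨star n * n, IsSelfAdjoint.star_mul_self n⟩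
    (-(1 + θ * Complex.I) * (2 / d ^ 2 : ℝ))
  rw [hp, Complex.ofReal_zero, mul_zero, Complex.exp_zero] at e
  have e' := hsm x (NormedSpace.exp ((-(1 + θ * Complex.I) * (2 / d ^ 2 : ℝ)) • (star n * n)))
  rwa [e, mul_one] at e'

include h1 in
lemma map_eq_slopeLinearMap (hcont : Continuous φ) (x : A) : φ x = hsm.slopeLinearMap h1 x := by
  have := hsm.nontrivial
  refine (hsm.map_eq_zero_or_eq h1 x).elim (fun h0 ↦ ?_) id
  set c := hsm.slopeLinearMap h1 x with hc
  by_contra hne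
  have hc0 : c ≠ 0 := fun h ↦ hne (h0.trans h.symm)
  have hg : Continuous fun t : ℝ ↦ ‖φ (c • 1 + t • (x - c • 1))‖ := by fun_prop
  have hφc : φ (c • 1) = c := by
    have := hsm (c • 1) 1
    simpa [h1, ← Algebra.algebraMap_eq_smul_one] using this
  obtain ⟨t, ht⟩ := mem_range_of_exists_le_of_exists_ge (c := ‖c‖ / 2) hg
    ⟨1, by simp [h0]; positivity⟩ ⟨0, by simp [hφc]⟩
  have hψ : hsm.slopeLinearMap h1 (c • 1 + t • (x - c • 1)) = c := by
    rw [← Complex.coe_smul]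
    simp [slopeLinearMap_one, ← hc]
  have hpos := norm_pos_iff.2 hc0
  rcases hsm.map_eq_zero_or_eq h1 (c • 1 + t • (x - c • 1)) with h | h
  · simp only [h, norm_zero] at ht
    linarith
  · simp only [h, hψ] at ht
    linarith

include hsm h1 in
lemma isCharacter (hcont : Continuous φ) : IsCharacter φ := by
  have e : φ = hsm.slopeLinearMap h1 := funext (hsm.map_eq_slopeLinearMap h1 hcont)
  refine ⟨fun h ↦ by simp [h] at h1, ?_, fun x y ↦ ?_⟩
  · rw [e]
    exact (hsm.slopeLinearMap h1).isLinear
  · rw [e, slopeLinearMap_mul]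

end SpectrallyMultiplicative

end CStar

theorem stmt_18 {A : Type*} [NormedRing A] [StarRing A] [CStarRing A]
    [NormedAlgebra ℂ A] [CompleteSpace A] [StarModule ℂ A]
    (φ : A → ℂ) (hcont : Continuous φ) (hsm : SpectrallyMultiplicative φ) :
    IsCharacter φ ∨ IsCharacter (-φ) := by
  let _ : CStarAlgebra A := {}
  rcases mul_self_eq_one_iff.1 (hsm.map_mul_map_eq_one (mul_one 1)) with h1 | h1
  · exact Or.inl (hsm.isCharacter h1 hcont)
  · have hneg : SpectrallyMultiplicative (-φ) := fun x y ↦ by simpa using hsm x y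
    exact Or.inr (hneg.isCharacter (by simp [h1]) hcont.neg)
end
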